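/- arXiv:dg-ga/9604003 — 2 statements merged into one kernel-verified Lean document; each statement's English description precedes it below -/
import Mathlib

section
/- Let f be a profile function whose derivative f' extends continuously to [-1,1] and such that x ↦ f(x)·f''(x) is interval integrable on [-1,1]; set K(x) = -f''(x)/2, and let Λ : ℕ → ℝ be the strictly increasing enumeration of E(f) = ⋃_{k ≥ 0} Spec L_k. If ∫_{-1}^{1} f(x) dx ≥ 2, then for every m ≥ 1, Λ(m) ≤ m² + (∫_{-1}^{1} f(x)K(x) dx)/(2∫_{-1}^{1} f(x) dx); consequently Λ(m) < m² + m for all sufficiently large m, and the sequence m ↦ (m² + m) - Λ(m) tends to +∞ as m → ∞. -/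
open Set MeasureTheory intervalIntegral Filter

/-- A profile function for a surface of revolution diffeomorphic to `S²` of area `4π`:
continuous on `[-1,1]`, smooth and positive on `(-1,1)`, vanishing at `±1`,
with derivative `2` at `-1` and `-2` at `1`. -/
structure IsProfile (f : ℝ → ℝ) : Prop where
  contOn : ContinuousOn f (Icc (-1) 1)
  smoothOn : ContDiffOn ℝ (⊤ : ℕ∞) f (Ioo (-1) 1)
  pos : ∀ x ∈ Ioo (-1:ℝ) 1, 0 < f x
  zero_neg_one : f (-1) = 0
  zero_one : f 1 = 0
  deriv_neg_one : HasDerivAt f 2 (-1)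
  deriv_one : HasDerivAt f (-2) 1

/-- `λ` is an eigenvalue of the Sturm–Liouville operator
`L_k = -(d/dx)(f(x) d/dx) + k²/f(x)` on `(-1,1)`, with Dirichlet boundary
conditions at `±1` when `k ≥ 1`. -/
def InSpec (f : ℝ → ℝ) (k : ℕ) (lam : ℝ) : Prop :=
  ∃ u : ℝ → ℝ, ContinuousOn u (Icc (-1) 1) ∧ ContDiffOn ℝ (⊤ : ℕ∞) u (Ioo (-1) 1) ∧
    (∃ x ∈ Ioo (-1:ℝ) 1, u x ≠ 0) ∧
    (1 ≤ k → u (-1) = 0 ∧ u 1 = 0) ∧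
    ∀ x ∈ Ioo (-1:ℝ) 1,
      -(deriv (fun y => f y * deriv u y) x) + ((k:ℝ)^2 / f x) * u x = lam * u x

/-- The spectrum of `L_k`. -/
def Spec (f : ℝ → ℝ) (k : ℕ) : Set ℝ := {lam | InSpec f k lam}

/-- The set of distinct eigenvalues of the Laplacian of the surface of
revolution determined by `f`. -/
def Eigs (f : ℝ → ℝ) : Set ℝ := ⋃ k : ℕ, Spec f k

open scoped Topology InnerProductSpace BoundedContinuousFunction

/-- A symmetric operator on a normed space `E` mapped into an inner product space `H` attains the
supremum of its Rayleigh quotient at an eigenvector, if it is bounded and compact from the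
`H`-norm to the `E`-norm. -/
theorem exists_eigenvector_rayleigh_max {E H : Type*} [NormedAddCommGroup E] [NormedSpace ℝ E]
    [NormedAddCommGroup H] [InnerProductSpace ℝ H] (J : E →L[ℝ] H) (T : E →ₗ[ℝ] E)
    (hsymm : ∀ v w, ⟪J (T v), J w⟫_ℝ = ⟪J v, J (T w)⟫_ℝ)
    {C : ℝ} (hC : ∀ v, ‖T v‖ ≤ C * ‖J v‖)
    (hcomp : ∀ v : ℕ → E, (∀ n, ‖J (v n)‖ ≤ 1) →
      ∃ w, ∃ φ : ℕ → ℕ, StrictMono φ ∧ Tendsto (fun n => T (v (φ n))) atTop (𝓝 w))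
    (hpos : ∃ v, 0 < ⟪J (T v), J v⟫_ℝ) :
    ∃ M : ℝ, 0 < M ∧ (∃ w, w ≠ 0 ∧ T w = M • w) ∧
      ∀ v, ⟪J (T v), J v⟫_ℝ ≤ M * ‖J v‖ ^ 2 := by
  set q : E → ℝ := fun v => ⟪J (T v), J v⟫_ℝ with hq
  set D₀ : ℝ := ‖J‖ * C with hD₀
  have hqabs : ∀ v, |q v| ≤ D₀ * ‖J v‖ ^ 2 := by
    intro v
    calc |q v| ≤ ‖J (T v)‖ * ‖J v‖ := abs_real_inner_le_norm _ _
      _ ≤ (‖J‖ * (C * ‖J v‖)) * ‖J v‖ := by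
        gcongr
        exact (J.le_opNorm _).trans (by gcongr; exact hC v)
      _ = D₀ * ‖J v‖ ^ 2 := by rw [hD₀]; ring
  have hqsmul : ∀ (c : ℝ) v, q (c • v) = c ^ 2 * q v := by
    intro c v
    simp only [hq, map_smul, inner_smul_left, inner_smul_right]
    simp; ring
  set S : Set ℝ := {r | ∃ v, ‖J v‖ = 1 ∧ q v = r} with hS
  have hSbdd : BddAbove S := by
    refine ⟨D₀, ?_⟩
    rintro r ⟨v, hv, rfl⟩
    have := hqabs v
    rw [hv] at this
    linarith [le_abs_self (q v)]
  obtain ⟨v₀, hv₀⟩ := hpos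
  have hnorm : ∀ v, J v ≠ 0 → ‖J (‖J v‖⁻¹ • v)‖ = 1 := by
    intro v hv
    rw [map_smul, norm_smul, norm_inv, norm_norm, inv_mul_cancel₀ (norm_ne_zero_iff.2 hv)]
  have hJv₀ : J v₀ ≠ 0 := by
    intro h
    simp [h] at hv₀
  have hSne : S.Nonempty := ⟨_, _, hnorm v₀ hJv₀, rfl⟩
  set M := sSup S with hM
  have hle : ∀ v, q v ≤ M * ‖J v‖ ^ 2 := by
    intro v
    by_cases hv : J v = 0
    · simp [hq, hv]
    · have h1 : q (‖J v‖⁻¹ • v) ≤ M := le_csSup hSbdd ⟨_, hnorm v hv, rfl⟩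
      rw [hqsmul, inv_pow, inv_mul_le_iff₀ (by positivity)] at h1
      linarith
  have hMpos : 0 < M := by
    have h1 := hle v₀
    have h2 : 0 < M * ‖J v₀‖ ^ 2 := lt_of_lt_of_le hv₀ h1
    exact pos_of_mul_pos_left h2 (by positivity)
  refine ⟨M, hMpos, ?_, hle⟩
  -- the residual of an almost maximizing vector is small
  have hD₀' : 0 ≤ D₀ := by
    have h1 := (abs_nonneg _).trans (hqabs v₀)
    exact nonneg_of_mul_nonneg_left h1 (by positivity)
  have hres : ∀ v, ‖J (M • v - T v)‖ ^ 2 ≤ (M + D₀) * (M * ‖J v‖ ^ 2 - q v) := by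
    intro v
    set r := M • v - T v with hr
    have hD : 0 < M + D₀ := by linarith
    set t : ℝ := (M + D₀)⁻¹ with ht
    have h0 := hle (v - t • r)
    have hvr : M * ⟪J v, J r⟫_ℝ - ⟪J (T v), J r⟫_ℝ = ‖J r‖ ^ 2 := by
      rw [← real_inner_self_eq_norm_sq]
      have hJr : J r = M • J v - J (T v) := by rw [hr, map_sub, map_smul]
      nth_rewrite 3 [hJr]
      rw [inner_sub_left, inner_smul_left]
      simp
    have hexp : q (v - t • r) = q v - 2 * t * ⟪J (T v), J r⟫_ℝ + t ^ 2 * q r := by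
      simp only [hq, map_sub, map_smul, inner_sub_left, inner_sub_right, inner_smul_left,
        inner_smul_right, hsymm r v, real_inner_comm (J (T v)) (J r)]
      simp; ring
    have hexp2 : ‖J (v - t • r)‖ ^ 2
        = ‖J v‖ ^ 2 - 2 * t * ⟪J v, J r⟫_ℝ + t ^ 2 * ‖J r‖ ^ 2 := by
      simp only [← real_inner_self_eq_norm_sq, map_sub, map_smul, inner_sub_left,
        inner_sub_right, inner_smul_left, inner_smul_right, real_inner_comm (J v) (J r)]
      simp; ring
    rw [hexp, hexp2] at h0
    have h1 : -q r ≤ D₀ * ‖J r‖ ^ 2 := (neg_le_abs _).trans (hqabs r)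
    have h2 : t * (M + D₀) = 1 := inv_mul_cancel₀ hD.ne'
    have h3 : 0 ≤ (M * ‖J v‖ ^ 2 - q v) - 2 * t * ‖J r‖ ^ 2
        + t ^ 2 * ((M + D₀) * ‖J r‖ ^ 2) := by
      have : t ^ 2 * (-q r) ≤ t ^ 2 * (D₀ * ‖J r‖ ^ 2) := by gcongr
      have h6 : 2 * t * ‖J r‖ ^ 2
          = 2 * t * (M * ⟪J v, J r⟫_ℝ) - 2 * t * ⟪J (T v), J r⟫_ℝ := by rw [← hvr]; ring
      linarith
    have h4 : t ^ 2 * ((M + D₀) * ‖J r‖ ^ 2) = t * ‖J r‖ ^ 2 := by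
      rw [show t ^ 2 * ((M + D₀) * ‖J r‖ ^ 2) = t * (t * (M + D₀)) * ‖J r‖ ^ 2 by ring, h2, mul_one]
    rw [h4] at h3
    have h5 : t * ‖J r‖ ^ 2 ≤ M * ‖J v‖ ^ 2 - q v := by linarith
    rwa [ht, inv_mul_le_iff₀ hD] at h5
  obtain ⟨s, -, hs_tendsto, hs_mem⟩ := exists_seq_tendsto_sSup hSne hSbdd
  choose v hv1 hvq using hs_mem
  obtain ⟨w, φ, hφ, hw⟩ := hcomp v fun n => (hv1 n).le
  have hr0 : Tendsto (fun n => J (M • v (φ n) - T (v (φ n)))) atTop (𝓝 0) := by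
    have h1 : Tendsto (fun n => (M + D₀) * (M * ‖J (v (φ n))‖ ^ 2 - q (v (φ n)))) atTop (𝓝 0) := by
      have h2 : Tendsto (fun n => s (φ n)) atTop (𝓝 M) := hs_tendsto.comp hφ.tendsto_atTop
      have h3 := (h2.const_sub M).const_mul (M + D₀)
      simp only [sub_self, mul_zero] at h3
      refine h3.congr fun n => ?_
      rw [hv1, hvq]; ring
    have h2 := squeeze_zero (fun n => by positivity) (fun n => hres (v (φ n))) h1
    have h3 : Tendsto (fun n => ‖J (M • v (φ n) - T (v (φ n)))‖) atTop (𝓝 0) := by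
      have := h2.sqrt
      simpa using this
    exact tendsto_zero_iff_norm_tendsto_zero.2 h3
  have hTJ : ∀ (a : ℕ → E), Tendsto (fun n => J (a n)) atTop (𝓝 0) →
      Tendsto (fun n => T (a n)) atTop (𝓝 0) := by
    intro a ha
    refine squeeze_zero_norm (fun n => hC (a n)) ?_
    simpa using ha.norm.const_mul C
  have hTw : Tendsto (fun n => T (T (v (φ n)))) atTop (𝓝 (T w)) := by
    have h1 : Tendsto (fun n => J (T (v (φ n)) - w)) atTop (𝓝 0) := by
      have := (J.continuous.tendsto _).comp (hw.sub_const w)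
      rwa [sub_self, map_zero] at this
    have h2 := (hTJ _ h1).add_const (T w)
    simpa using h2
  refine ⟨w, ?_, ?_⟩
  · rintro rfl
    have h1 : Tendsto (fun n => J (T (v (φ n)))) atTop (𝓝 0) := by
      have := (J.continuous.tendsto _).comp hw
      rwa [map_zero] at this
    have h2 := (hr0.add h1).norm
    have h3 : (fun n => ‖J (M • v (φ n) - T (v (φ n))) + J (T (v (φ n)))‖) = fun _ => M := by
      ext n
      rw [← map_add, sub_add_cancel, map_smul, norm_smul, hv1, mul_one,
        Real.norm_of_nonneg hMpos.le]
    rw [h3] at h2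
    have := tendsto_nhds_unique h2 tendsto_const_nhds
    simp only [add_zero, norm_zero] at this
    exact hMpos.ne this
  · have h1 := hTJ _ hr0
    simp only [map_sub, map_smul] at h1
    have h2 := (hw.const_smul M).sub hTw
    have := tendsto_nhds_unique h1 h2
    exact (sub_eq_zero.1 this.symm).symm

/-- Arzelà–Ascoli for functions `x ↦ ⟪g x, h⟫` with `h` in the unit ball. -/
theorem exists_subseq_tendsto_inner {X H : Type*} [TopologicalSpace X] [CompactSpace X]
    [NormedAddCommGroup H] [InnerProductSpace ℝ H] (g : C(X, H)) (h : ℕ → H)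
    (hh : ∀ n, ‖h n‖ ≤ 1) (F : ℕ → C(X, ℝ)) (hF : ∀ n x, F n x = ⟪g x, h n⟫_ℝ) :
    ∃ w, ∃ φ : ℕ → ℕ, StrictMono φ ∧ Tendsto (fun n => F (φ n)) atTop (𝓝 w) := by
  set A : Set (X →ᵇ ℝ) := range fun n => BoundedContinuousFunction.mkOfCompact (F n) with hA
  have hcpt : IsCompact (closure A) := by
    refine BoundedContinuousFunction.arzela_ascoli (Metric.closedBall 0 ‖g‖)
      (isCompact_closedBall _ _) A ?_ ?_
    · rintro _ x ⟨n, rfl⟩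
      simp only [BoundedContinuousFunction.mkOfCompact_apply, hF, mem_closedBall_zero_iff]
      calc ‖⟪g x, h n⟫_ℝ‖ ≤ ‖g x‖ * ‖h n‖ := norm_inner_le_norm _ _
        _ ≤ ‖g‖ * 1 := by
          gcongr
          · exact g.norm_coe_le_norm x
          · exact hh n
        _ = ‖g‖ := mul_one _
    · intro x
      rw [Metric.equicontinuousAt_iff_right]
      intro ε hε
      have := Metric.tendsto_nhds.1 (g.continuous.tendsto x) ε hε
      filter_upwards [this] with y hy
      rintro ⟨_, n, rfl⟩
      simp only [BoundedContinuousFunction.mkOfCompact_apply, hF, Real.dist_eq]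
      rw [← inner_sub_left]
      calc |⟪g x - g y, h n⟫_ℝ| ≤ ‖g x - g y‖ * ‖h n‖ := abs_real_inner_le_norm _ _
        _ ≤ ‖g x - g y‖ * 1 := by gcongr; exact hh n
        _ < ε := by rwa [mul_one, ← dist_eq_norm, dist_comm]
  obtain ⟨w, -, φ, hφ, hw⟩ := hcpt.tendsto_subseq
    (x := fun n => BoundedContinuousFunction.mkOfCompact (F n))
    fun n => subset_closure ⟨n, rfl⟩
  refine ⟨w.toContinuousMap, φ, hφ, ?_⟩
  rw [tendsto_iff_dist_tendsto_zero] at hw ⊢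
  exact hw

section Kernel

variable {X : Type*} [TopologicalSpace X] [FirstCountableTopology X] [CompactSpace X]
  [MeasurableSpace X] [BorelSpace X] {μ : Measure X} [IsFiniteMeasure μ]

/-- A bounded symmetric kernel that is continuous in one variable has an eigenfunction
at the maximum of its Rayleigh quotient over continuous functions. -/
theorem exists_kernel_eigenfunction (G : X → X → ℝ) (hmeas : Measurable (Function.uncurry G))
    {C : ℝ} (hC : ∀ x y, |G x y| ≤ C) (hsymm : ∀ x y, G x y = G y x)
    (hcont : ∀ᵐ y ∂μ, Continuous fun x => G x y) (hpos : 0 < ∫ x, ∫ y, G x y ∂μ ∂μ) :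
    ∃ M : ℝ, 0 < M ∧ (∃ w : C(X, ℝ), w ≠ 0 ∧ ∀ x, ∫ y, G x y * w y ∂μ = M * w x) ∧
      ∀ v : C(X, ℝ), ∫ x, (∫ y, G x y * v y ∂μ) * v x ∂μ ≤ M * ∫ x, v x ^ 2 ∂μ := by
  have hGm : ∀ x, Measurable (G x) := fun x => hmeas.of_uncurry_left
  have hLp : ∀ x, MemLp (G x) 2 μ := fun x =>
    MemLp.of_bound (hGm x).aestronglyMeasurable C (Eventually.of_forall fun y => hC x y)
  let J : C(X, ℝ) →L[ℝ] Lp ℝ 2 μ := ContinuousMap.toLp 2 μ ℝ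
  have hJ : ∀ v : C(X, ℝ), J v =ᵐ[μ] v := fun v => ContinuousMap.coeFn_toLp μ v
  have hinner : ∀ v w : C(X, ℝ), ⟪J v, J w⟫_ℝ = ∫ x, v x * w x ∂μ := by
    intro v w
    rw [L2.inner_def]
    refine integral_congr_ae ?_
    filter_upwards [hJ v, hJ w] with x h1 h2
    rw [h1, h2]; simp [mul_comm]
  let g₀ : X → Lp ℝ 2 μ := fun x => (hLp x).toLp (G x)
  have hginner : ∀ x (v : C(X, ℝ)), ⟪g₀ x, J v⟫_ℝ = ∫ y, G x y * v y ∂μ := by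
    intro x v
    rw [L2.inner_def]
    refine integral_congr_ae ?_
    filter_upwards [(hLp x).coeFn_toLp, hJ v] with y h1 h2
    rw [h1, h2]; simp [mul_comm]
  have hgcont : Continuous g₀ := by
    rw [continuous_iff_continuousAt]
    intro x
    rw [ContinuousAt, tendsto_iff_norm_sub_tendsto_zero]
    have hsq : ∀ z, ‖g₀ z - g₀ x‖ ^ 2 = ∫ y, (G z y - G x y) ^ 2 ∂μ := by
      intro z
      rw [← real_inner_self_eq_norm_sq, L2.inner_def]
      refine integral_congr_ae ?_
      filter_upwards [Lp.coeFn_sub (g₀ z) (g₀ x), (hLp x).coeFn_toLp, (hLp z).coeFn_toLp]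
        with y h1 h2 h3
      rw [h1, Pi.sub_apply, h2, h3]; simp [sq]
    have hlim : Tendsto (fun z => ∫ y, (G z y - G x y) ^ 2 ∂μ) (𝓝 x) (𝓝 (∫ y, (0 : ℝ) ∂μ)) := by
      refine tendsto_integral_filter_of_dominated_convergence (fun _ => (2 * C) ^ 2)
        (Eventually.of_forall fun z => (((hGm z).sub (hGm x)).pow_const 2).aestronglyMeasurable)
        (Eventually.of_forall fun z => Eventually.of_forall fun y => ?_)
        (integrable_const _) ?_
      · rw [Real.norm_of_nonneg (sq_nonneg _), sq_le_sq]
        have h1 := abs_sub (G z y) (G x y)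
        have h2 := hC z y
        have h3 := hC x y
        have h4 : |G z y - G x y| ≤ 2 * C := by linarith
        exact h4.trans (le_abs_self _)
      · filter_upwards [hcont] with y hy
        have := ((hy.tendsto x).sub_const (G x y)).pow 2
        simpa using this
    rw [integral_zero] at hlim
    have := hlim.sqrt
    simp only [← hsq, Real.sqrt_sq (norm_nonneg _), Real.sqrt_zero] at this
    exact this
  let g : C(X, Lp ℝ 2 μ) := ⟨g₀, hgcont⟩
  let T : C(X, ℝ) →ₗ[ℝ] C(X, ℝ) :=
    { toFun := fun v => ⟨fun x => ⟪g₀ x, J v⟫_ℝ, by fun_prop⟩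
      map_add' := fun v w => by ext x; simp [inner_add_right]
      map_smul' := fun c v => by ext x; simp [inner_smul_right] }
  have hT : ∀ v x, T v x = ∫ y, G x y * v y ∂μ := fun v x => hginner x v
  have hTsymm : ∀ v w, ⟪J (T v), J w⟫_ℝ = ⟪J v, J (T w)⟫_ℝ := by
    intro v w
    rw [hinner, hinner]
    simp only [hT, ← MeasureTheory.integral_mul_const, ← MeasureTheory.integral_const_mul]
    rw [integral_integral_swap]
    · refine integral_congr_ae (Eventually.of_forall fun y => ?_)
      refine integral_congr_ae (Eventually.of_forall fun x => ?_)
      simp only [hsymm x y]; ring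
    · refine Integrable.of_bound (C := C * ‖v‖ * ‖w‖) ?_ (Eventually.of_forall ?_)
      · exact ((hmeas.mul (v.measurable.comp measurable_snd)).mul
          (w.measurable.comp measurable_fst)).aestronglyMeasurable
      · rintro ⟨x, y⟩
        simp only [Function.uncurry, norm_mul]
        have h1 := hC x y
        have h2 := v.norm_coe_le_norm y
        have h3 := w.norm_coe_le_norm x
        have h0 : 0 ≤ C := (abs_nonneg _).trans h1
        gcongr
        exact h1
  obtain ⟨M, hM, ⟨w, hw0, hw⟩, hmax⟩ := exists_eigenvector_rayleigh_max J T hTsymm (C := ‖g‖)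
    (fun v => by
      rw [ContinuousMap.norm_le _ (by positivity)]
      intro x
      calc ‖⟪g₀ x, J v⟫_ℝ‖ ≤ ‖g₀ x‖ * ‖J v‖ := norm_inner_le_norm _ _
        _ ≤ ‖g‖ * ‖J v‖ := by gcongr; exact g.norm_coe_le_norm x)
    (fun v hv => exists_subseq_tendsto_inner g (fun n => J (v n)) hv (fun n => T (v n))
      fun n x => rfl)
    ⟨1, by rw [hinner]; simpa [hT] using hpos⟩
  refine ⟨M, hM, ⟨w, hw0, fun x => ?_⟩, fun v => ?_⟩
  · rw [← hT, hw]; rfl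
  · have := hmax v
    rw [← real_inner_self_eq_norm_sq, hinner, hinner] at this
    simpa [hT, sq] using this

end Kernel

/-- `s` is an arc coordinate for the profile `f`: a primitive of `1 / f` on `(-1, 1)`
mapping it onto `ℝ`. -/
structure IsArc (f s : ℝ → ℝ) : Prop where
  hasDerivAt : ∀ x ∈ Ioo (-1 : ℝ) 1, HasDerivAt s (1 / f x) x
  measurable : Measurable s
  tendsto_top : Tendsto s (𝓝[<] 1) atTop
  tendsto_bot : Tendsto s (𝓝[>] (-1)) atBot

theorem IsProfile.differentiableAt {f : ℝ → ℝ} (hf : IsProfile f) {x : ℝ}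
    (hx : x ∈ Ioo (-1 : ℝ) 1) : DifferentiableAt ℝ f x :=
  (hf.smoothOn.differentiableOn (by simp)).differentiableAt (isOpen_Ioo.mem_nhds hx)

/-- A primitive of `1 / f` blows up at a zero of `f` at which `f` is differentiable. -/
theorem tendsto_atTop_of_hasDerivAt_inv {f s : ℝ → ℝ} {c : ℝ}
    (hpos : ∀ x ∈ Ioo (-1 : ℝ) 1, 0 < f x) (hf1 : f 1 = 0) (hd : HasDerivAt f c 1)
    (hs : ∀ x ∈ Ioo (-1 : ℝ) 1, HasDerivAt s (1 / f x) x) : Tendsto s (𝓝[<] 1) atTop := by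
  set L : ℝ := |c| + 1 with hL
  have hLpos : 0 < L := by positivity
  have h1 : ∀ᶠ x in 𝓝[<] (1 : ℝ), f x ≤ L * (1 - x) := by
    have h2 := (hd.hasDerivWithinAt (s := Iio 1)).isLittleO.def (c := 1) one_pos
    filter_upwards [h2, self_mem_nhdsWithin] with x hx hx1
    have hx1 : x < 1 := hx1
    rw [hf1] at hx
    simp only [sub_zero, smul_eq_mul, one_mul, Real.norm_eq_abs] at hx
    rw [abs_of_neg (by linarith : x - 1 < 0)] at hx
    have h3 := (abs_le.1 hx).2
    have h4 : (x - 1) * c ≤ (1 - x) * |c| := by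
      nlinarith [neg_abs_le c]
    rw [hL]; nlinarith
  obtain ⟨b, hb1, hb⟩ := (mem_nhdsLT_iff_exists_Ioo_subset' (show (-1 : ℝ) < 1 by norm_num)).1 h1
  have hb1 : b < 1 := hb1
  set a : ℝ := (max b 0 + 1) / 2 with ha
  have hmax : max b 0 < 1 := max_lt hb1 one_pos
  have hab : b < a := by have := le_max_left b 0; rw [ha]; linarith
  have ha0 : 0 < a := by have := le_max_right b 0; rw [ha]; linarith
  have ha1 : a < 1 := by rw [ha]; linarith
  have hder : ∀ x ∈ Ico a 1, HasDerivAt (fun x => s x + L⁻¹ * Real.log (1 - x))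
      (1 / f x + L⁻¹ * (-1 / (1 - x))) x := by
    intro x hx
    refine (hs x ⟨by linarith [hx.1], hx.2⟩).add ?_
    refine HasDerivAt.const_mul _ ?_
    exact ((hasDerivAt_id x).const_sub 1).log (sub_pos.2 hx.2).ne'
  have hmono : MonotoneOn (fun x => s x + L⁻¹ * Real.log (1 - x)) (Ico a 1) := by
    refine monotoneOn_of_deriv_nonneg (convex_Ico a 1)
      (fun x hx => (hder x hx).continuousAt.continuousWithinAt) ?_ ?_
    · intro x hx
      rw [interior_Ico] at hx
      exact (hder x ⟨hx.1.le, hx.2⟩).differentiableAt.differentiableWithinAt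
    · intro x hx
      rw [interior_Ico] at hx
      rw [(hder x ⟨hx.1.le, hx.2⟩).deriv]
      have h5 : f x ≤ L * (1 - x) := hb ⟨hab.trans hx.1, hx.2⟩
      have h6 : 0 < f x := hpos x ⟨by linarith [hx.1], hx.2⟩
      have h7 : 1 / (L * (1 - x)) ≤ 1 / f x := one_div_le_one_div_of_le h6 h5
      have h8 : L⁻¹ * (-1 / (1 - x)) = -(1 / (L * (1 - x))) := by
        rw [one_div, mul_inv]; ring
      rw [h8]; linarith
  have hlog : Tendsto (fun x : ℝ => (s a + L⁻¹ * Real.log (1 - a)) + L⁻¹ * (-Real.log (1 - x)))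
      (𝓝[<] 1) atTop := by
    refine tendsto_atTop_add_const_left _ _ (Tendsto.const_mul_atTop (by positivity) ?_)
    refine tendsto_neg_atBot_atTop.comp (Real.tendsto_log_nhdsGT_zero.comp ?_)
    refine tendsto_nhdsWithin_iff.2 ⟨?_, ?_⟩
    · have : Tendsto (fun x : ℝ => 1 - x) (𝓝 1) (𝓝 (1 - 1)) := tendsto_id.const_sub 1
      rw [sub_self] at this
      exact this.mono_left nhdsWithin_le_nhds
    · filter_upwards [self_mem_nhdsWithin] with x hx
      have hx : x < 1 := hx
      simpa using hx
  refine tendsto_atTop_mono' _ ?_ hlog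
  filter_upwards [Ioo_mem_nhdsLT ha1] with x hx
  have := hmono ⟨le_rfl, ha1⟩ ⟨hx.1.le, hx.2⟩ hx.1.le
  simp only at this
  linarith

theorem IsProfile.exists_isArc {f : ℝ → ℝ} (hf : IsProfile f) : ∃ s, IsArc f s := by
  have hcont : ContinuousOn (fun x => 1 / f x) (Ioo (-1) 1) :=
    continuousOn_const.div (hf.contOn.mono Ioo_subset_Icc_self) fun x hx => (hf.pos x hx).ne'
  set s₀ : ℝ → ℝ := fun x => ∫ t in (0 : ℝ)..x, 1 / f t with hs₀
  have hd₀ : ∀ x ∈ Ioo (-1 : ℝ) 1, HasDerivAt s₀ (1 / f x) x := by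
    intro x hx
    refine integral_hasDerivAt_right ?_ ?_ (hcont.continuousAt (isOpen_Ioo.mem_nhds hx))
    · refine (hcont.mono ?_).intervalIntegrable
      exact (convex_Ioo (-1 : ℝ) 1).ordConnected.uIcc_subset (by norm_num) hx
    · exact hcont.stronglyMeasurableAtFilter isOpen_Ioo x hx
  classical
  set s : ℝ → ℝ := (Ioo (-1 : ℝ) 1).piecewise s₀ 0 with hs
  have hd : ∀ x ∈ Ioo (-1 : ℝ) 1, HasDerivAt s (1 / f x) x := by
    intro x hx
    refine (hd₀ x hx).congr_of_eventuallyEq ?_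
    filter_upwards [isOpen_Ioo.mem_nhds hx] with y hy
    exact piecewise_eq_of_mem _ _ _ hy
  refine ⟨s, hd, ?_, tendsto_atTop_of_hasDerivAt_inv hf.pos hf.zero_one hf.deriv_one hd, ?_⟩
  · exact ContinuousOn.measurable_piecewise
      (fun x hx => (hd₀ x hx).continuousAt.continuousWithinAt) continuousOn_const
      measurableSet_Ioo
  · have hneg : ∀ x ∈ Ioo (-1 : ℝ) 1, -x ∈ Ioo (-1 : ℝ) 1 := fun x hx =>
      ⟨by linarith [hx.2], by linarith [hx.1]⟩
    have h1 : Tendsto (fun x => -s (-x)) (𝓝[<] 1) atTop := by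
      refine tendsto_atTop_of_hasDerivAt_inv (f := fun x => f (-x)) (c := -2)
        (fun x hx => hf.pos _ (hneg x hx)) hf.zero_neg_one ?_ ?_
      · have := HasDerivAt.comp (h₂ := f) (1 : ℝ) hf.deriv_neg_one (hasDerivAt_neg 1)
        rwa [show (2 : ℝ) * -1 = -2 by norm_num] at this
      · intro x hx
        have := (HasDerivAt.comp x (hd (-x) (hneg x hx)) (hasDerivAt_neg x)).fun_neg
        rwa [mul_neg_one, neg_neg] at this
    have h2 : Tendsto (fun x : ℝ => -x) (𝓝[>] (-1)) (𝓝[<] 1) := by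
      have := tendsto_neg_nhdsGT (a := (-1 : ℝ))
      simpa using this
    have h3 := tendsto_neg_atTop_atBot.comp (h1.comp h2)
    refine h3.congr fun x => ?_
    simp

open Classical in
/-- The Green kernel of the operator `L_k`, written in an arc coordinate `s`. -/
noncomputable def greenKernel (s : ℝ → ℝ) (k x y : ℝ) : ℝ :=
  if x ∈ Ioo (-1 : ℝ) 1 ∧ y ∈ Ioo (-1 : ℝ) 1 then Real.exp (-(k * |s x - s y|)) / (2 * k) else 0

theorem greenKernel_of_mem {s : ℝ → ℝ} {k x y : ℝ} (hx : x ∈ Ioo (-1 : ℝ) 1)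
    (hy : y ∈ Ioo (-1 : ℝ) 1) :
    greenKernel s k x y = Real.exp (-(k * |s x - s y|)) / (2 * k) := by
  rw [greenKernel, if_pos ⟨hx, hy⟩]

theorem greenKernel_one {s : ℝ → ℝ} {k y : ℝ} : greenKernel s k 1 y = 0 := by
  rw [greenKernel, if_neg (by simp)]

theorem greenKernel_neg_one {s : ℝ → ℝ} {k y : ℝ} : greenKernel s k (-1) y = 0 := by
  rw [greenKernel, if_neg (by simp)]

theorem greenKernel_comm (s : ℝ → ℝ) (k x y : ℝ) : greenKernel s k x y = greenKernel s k y x := by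
  simp only [greenKernel, abs_sub_comm, and_comm]

theorem greenKernel_nonneg {s : ℝ → ℝ} {k : ℝ} (hk : 0 < k) (x y : ℝ) :
    0 ≤ greenKernel s k x y := by
  unfold greenKernel
  split_ifs <;> positivity

theorem greenKernel_le {s : ℝ → ℝ} {k : ℝ} (hk : 0 < k) (x y : ℝ) :
    greenKernel s k x y ≤ 1 / (2 * k) := by
  unfold greenKernel
  split_ifs
  · gcongr
    rw [Real.exp_le_one_iff]
    have := abs_nonneg (s x - s y)
    nlinarith
  · positivity

theorem abs_greenKernel_le {s : ℝ → ℝ} {k : ℝ} (hk : 0 < k) (x y : ℝ) :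
    |greenKernel s k x y| ≤ 1 / (2 * k) := by
  rw [abs_of_nonneg (greenKernel_nonneg hk x y)]
  exact greenKernel_le hk x y

theorem greenKernel_le_mul {s : ℝ → ℝ} {k l : ℝ} (hk : 0 < k) (hkl : k ≤ l) (x y : ℝ) :
    greenKernel s l x y ≤ k / l * greenKernel s k x y := by
  have hl : 0 < l := hk.trans_le hkl
  unfold greenKernel
  split_ifs
  · have h1 : k / l * (Real.exp (-(k * |s x - s y|)) / (2 * k))
        = Real.exp (-(k * |s x - s y|)) / (2 * l) := by field_simp
    rw [h1]
    gcongr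
  · simp

theorem measurable_greenKernel {s : ℝ → ℝ} (hs : Measurable s) (k : ℝ) :
    Measurable (Function.uncurry (greenKernel s k)) := by
  refine Measurable.ite ?_ ?_ measurable_const
  · exact measurableSet_Ioo.prod measurableSet_Ioo
  · have h1 : Measurable fun p : ℝ × ℝ => s p.1 := hs.comp measurable_fst
    have h2 : Measurable fun p : ℝ × ℝ => s p.2 := hs.comp measurable_snd
    exact (Real.measurable_exp.comp (((h1.sub h2).abs.const_mul k).neg)).div_const _

namespace IsArc

variable {f s : ℝ → ℝ}

theorem continuousOn_greenKernel (hs : IsArc f s) {k : ℝ} (hk : 0 < k) {y : ℝ}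
    (hy : y ∈ Ioo (-1 : ℝ) 1) :
    ContinuousOn (fun x => greenKernel s k x y) (Icc (-1) 1) := by
  have hlim : ∀ l : Filter ℝ, Tendsto (fun x => |s x - s y|) l atTop →
      Tendsto (fun x => Real.exp (-(k * |s x - s y|)) / (2 * k)) l (𝓝 0) := by
    intro l hl
    have := (Real.tendsto_exp_neg_atTop_nhds_zero.comp (hl.const_mul_atTop hk)).div_const (2 * k)
    simpa using this
  intro x hx
  rcases eq_or_lt_of_le hx.1 with rfl | hx1
  · refine ContinuousWithinAt.mono ?_ (Icc_subset_Ici_self)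
    rw [← continuousWithinAt_Ioi_iff_Ici, ContinuousWithinAt, greenKernel_neg_one]
    refine (hlim _ ?_).congr' ?_
    · exact tendsto_abs_atBot_atTop.comp (tendsto_atBot_add_const_right _ (-s y) hs.tendsto_bot)
    · filter_upwards [Ioo_mem_nhdsGT (show (-1 : ℝ) < 1 by norm_num)] with z hz
      rw [greenKernel_of_mem hz hy]
  rcases eq_or_lt_of_le hx.2 with rfl | hx2
  · refine ContinuousWithinAt.mono ?_ (Icc_subset_Iic_self)
    rw [← continuousWithinAt_Iio_iff_Iic, ContinuousWithinAt, greenKernel_one]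
    refine (hlim _ ?_).congr' ?_
    · exact tendsto_abs_atTop_atTop.comp (tendsto_atTop_add_const_right _ (-s y) hs.tendsto_top)
    · filter_upwards [Ioo_mem_nhdsLT (show (-1 : ℝ) < 1 by norm_num)] with z hz
      rw [greenKernel_of_mem hz hy]
  · refine ContinuousAt.continuousWithinAt ?_
    have hsx := (hs.hasDerivAt x ⟨hx1, hx2⟩).continuousAt
    have h1 : ContinuousAt (fun x => Real.exp (-(k * |s x - s y|)) / (2 * k)) x := by fun_prop
    refine h1.congr ?_
    filter_upwards [isOpen_Ioo.mem_nhds (show x ∈ Ioo (-1 : ℝ) 1 from ⟨hx1, hx2⟩)] with z hz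
    rw [greenKernel_of_mem hz hy]

theorem continuousOn_integral_greenKernel (hs : IsArc f s) {k : ℝ} (hk : 0 < k) {v : ℝ → ℝ}
    (hv : Continuous v) :
    ContinuousOn (fun x => ∫ y in (-1 : ℝ)..1, greenKernel s k x y * v y) (Icc (-1) 1) := by
  intro x hx
  refine continuousWithinAt_of_dominated_interval (bound := fun y => 1 / (2 * k) * |v y|)
    (Eventually.of_forall fun z => ?_)
    (Eventually.of_forall fun z => Eventually.of_forall fun y _ => ?_) ?_ ?_
  · exact ((measurable_greenKernel hs.measurable k).of_uncurry_left.mul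
      hv.measurable).aestronglyMeasurable
  · rw [norm_mul]
    gcongr
    · exact abs_greenKernel_le hk z y
    · exact le_rfl
  · exact (hv.abs.const_mul _).intervalIntegrable _ _
  · have h1 : ∀ᵐ y : ℝ, y ≠ 1 := Measure.ae_ne volume 1
    filter_upwards [h1] with y hy1 hy
    rw [uIoc_of_le (by norm_num)] at hy
    exact (hs.continuousOn_greenKernel hk ⟨hy.1, lt_of_le_of_ne hy.2 hy1⟩ x hx).mul
      continuousWithinAt_const

theorem intervalIntegrable_greenKernel_mul (hs : IsArc f s) {k : ℝ} (hk : 0 < k) {v : ℝ → ℝ}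
    (hv : Continuous v) (x a b : ℝ) :
    IntervalIntegrable (fun y => greenKernel s k x y * v y) volume a b := by
  rw [intervalIntegrable_iff]
  exact (intervalIntegrable_iff.1 (hv.intervalIntegrable a b)).bdd_mul
    (measurable_greenKernel hs.measurable k).of_uncurry_left.aestronglyMeasurable
    (Eventually.of_forall fun y => abs_greenKernel_le hk x y)

theorem monotoneOn (hs : IsArc f s) (hpos : ∀ x ∈ Ioo (-1 : ℝ) 1, 0 < f x) :
    MonotoneOn s (Ioo (-1) 1) := by
  refine monotoneOn_of_deriv_nonneg (convex_Ioo _ _)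
    (fun x hx => (hs.hasDerivAt x hx).continuousAt.continuousWithinAt)
    (fun x hx => ?_) fun x hx => ?_
  · rw [interior_Ioo] at hx
    exact (hs.hasDerivAt x hx).differentiableAt.differentiableWithinAt
  · rw [interior_Ioo] at hx
    rw [(hs.hasDerivAt x hx).deriv]
    have := hpos x hx
    positivity

/-- The Green potential `w` of `v` solves `f w' = P`, `P' = (k² / f) w - v`, with `P` bounded. -/
theorem exists_flux (hs : IsArc f s) (hpos : ∀ x ∈ Ioo (-1 : ℝ) 1, 0 < f x) {k : ℝ} (hk : 0 < k)
    {v : ℝ → ℝ}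
    (hv : Continuous v) :
    ∃ (P : ℝ → ℝ) (B : ℝ), ∀ x ∈ Ioo (-1 : ℝ) 1, |P x| ≤ B ∧
      HasDerivAt (fun x => ∫ y in (-1 : ℝ)..1, greenKernel s k x y * v y) (P x / f x) x ∧
      HasDerivAt P (k ^ 2 / f x * (∫ y in (-1 : ℝ)..1, greenKernel s k x y * v y) - v x) x := by
  have hmono := hs.monotoneOn hpos
  obtain ⟨V, hV⟩ : ∃ V, ∀ y ∈ Icc (-1 : ℝ) 1, |v y| ≤ V :=
    isCompact_Icc.exists_bound_of_continuousOn hv.continuousOn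
  have hV0 : 0 ≤ V := (abs_nonneg _).trans (hV 0 (by norm_num))
  set a : ℝ → ℝ := fun y => Real.exp (k * s y) * v y with ha
  set b : ℝ → ℝ := fun y => Real.exp (-(k * s y)) * v y with hb
  have ham : Measurable a :=
    (Real.measurable_exp.comp (hs.measurable.const_mul k)).mul hv.measurable
  have hbm : Measurable b :=
    (Real.measurable_exp.comp (hs.measurable.const_mul k).neg).mul hv.measurable
  have hdom_a : ∀ x ∈ Ioo (-1 : ℝ) 1, ∀ y ∈ uIoc (-1) x, ‖a y‖ ≤ Real.exp (k * s x) * V := by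
    intro x hx y hy
    rw [uIoc_of_le hx.1.le] at hy
    have h1 : s y ≤ s x := hmono ⟨hy.1, hy.2.trans_lt hx.2⟩ hx hy.2
    rw [ha, norm_mul, Real.norm_of_nonneg (Real.exp_pos _).le]
    gcongr
    exact hV y ⟨hy.1.le, hy.2.trans hx.2.le⟩
  have hdom_b : ∀ x ∈ Ioo (-1 : ℝ) 1, ∀ᵐ y, y ∈ uIoc x 1 → ‖b y‖ ≤ Real.exp (-(k * s x)) * V := by
    intro x hx
    have h1 : ∀ᵐ y : ℝ, y ≠ 1 := Measure.ae_ne volume 1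
    filter_upwards [h1] with y hy1 hy
    rw [uIoc_of_le hx.2.le] at hy
    have h1 : s x ≤ s y := hmono hx ⟨hx.1.trans hy.1, lt_of_le_of_ne hy.2 hy1⟩ hy.1.le
    rw [hb, norm_mul, Real.norm_of_nonneg (Real.exp_pos _).le]
    gcongr
    exact hV y ⟨(hx.1.trans hy.1).le, hy.2⟩
  have hint_a : ∀ x ∈ Ioo (-1 : ℝ) 1, IntervalIntegrable a volume (-1) x := fun x hx =>
    (intervalIntegrable_const (c := Real.exp (k * s x) * V)).mono_fun ham.aestronglyMeasurable <| by
      refine (ae_restrict_iff' measurableSet_uIoc).2 (Eventually.of_forall fun y hy => ?_)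
      exact (hdom_a x hx y hy).trans (le_abs_self _)
  have hint_b : ∀ x ∈ Ioo (-1 : ℝ) 1, IntervalIntegrable b volume x 1 := fun x hx =>
    (intervalIntegrable_const (c := Real.exp (-(k * s x)) * V)).mono_fun
      hbm.aestronglyMeasurable <| by
      refine (ae_restrict_iff' measurableSet_uIoc).2 ?_
      filter_upwards [hdom_b x hx] with y h1 hy
      exact (h1 hy).trans (le_abs_self _)
  set A : ℝ → ℝ := fun x => ∫ y in (-1 : ℝ)..x, a y with hA
  set B : ℝ → ℝ := fun x => ∫ y in x..1, b y with hB
  have hw : ∀ x ∈ Ioo (-1 : ℝ) 1, ∫ y in (-1 : ℝ)..1, greenKernel s k x y * v y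
      = (Real.exp (-(k * s x)) * A x + Real.exp (k * s x) * B x) / (2 * k) := by
    intro x hx
    rw [← integral_add_adjacent_intervals (hs.intervalIntegrable_greenKernel_mul hk hv x (-1) x)
      (hs.intervalIntegrable_greenKernel_mul hk hv x x 1), add_div]
    congr 1
    · rw [hA, mul_div_right_comm, ← intervalIntegral.integral_const_mul]
      refine integral_congr_Ioo_of_le hx.1.le fun y hy => ?_
      have hy' : y ∈ Ioo (-1 : ℝ) 1 := ⟨hy.1, hy.2.trans hx.2⟩
      simp only [greenKernel_of_mem hx hy', ha]
      rw [abs_of_nonneg (sub_nonneg.2 (hmono hy' hx hy.2.le)),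
        show -(k * (s x - s y)) = -(k * s x) + k * s y by ring, Real.exp_add]
      ring
    · rw [hB, mul_div_right_comm, ← intervalIntegral.integral_const_mul]
      refine integral_congr_Ioo_of_le hx.2.le fun y hy => ?_
      have hy' : y ∈ Ioo (-1 : ℝ) 1 := ⟨hx.1.trans hy.1, hy.2⟩
      simp only [greenKernel_of_mem hx hy', hb]
      rw [abs_of_nonpos (sub_nonpos.2 (hmono hx hy' hy.1.le)),
        show -(k * -(s x - s y)) = k * s x + -(k * s y) by ring, Real.exp_add]
      ring
  refine ⟨fun x => (-(Real.exp (-(k * s x)) * A x) + Real.exp (k * s x) * B x) / 2, 2 * V,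
    fun x hx => ?_⟩
  have hsx := hs.hasDerivAt x hx
  have hE : HasDerivAt (fun x => Real.exp (k * s x)) (Real.exp (k * s x) * (k * (1 / f x))) x :=
    (hsx.const_mul k).exp
  have hE' : HasDerivAt (fun x => Real.exp (-(k * s x)))
      (Real.exp (-(k * s x)) * (-(k * (1 / f x)))) x := (hsx.const_mul k).fun_neg.exp
  have hA' : HasDerivAt A (a x) x :=
    integral_hasDerivAt_right (hint_a x hx)
      ham.stronglyMeasurable.stronglyMeasurableAtFilter
      (hE.continuousAt.mul hv.continuousAt)
  have hB' : HasDerivAt B (-b x) x :=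
    integral_hasDerivAt_left (hint_b x hx)
      hbm.stronglyMeasurable.stronglyMeasurableAtFilter
      (hE'.continuousAt.mul hv.continuousAt)
  have hfx := (hpos x hx).ne'
  have hee : Real.exp (-(k * s x)) * Real.exp (k * s x) = 1 := by
    rw [← Real.exp_add]; simp
  refine ⟨?_, ?_, ?_⟩
  · have h1 : |A x| ≤ Real.exp (k * s x) * V * |x - (-1)| :=
      norm_integral_le_of_norm_le_const (hdom_a x hx)
    have h2 : |B x| ≤ Real.exp (-(k * s x)) * V * |1 - x| :=
      norm_integral_le_of_norm_le_const_ae (hdom_b x hx)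
    have hx1 : |x - (-1)| ≤ 2 := by
      rw [abs_le]; constructor <;> linarith [hx.1, hx.2]
    have hx2 : |1 - x| ≤ 2 := by
      rw [abs_le]; constructor <;> linarith [hx.1, hx.2]
    have h3 : |Real.exp (-(k * s x)) * A x| ≤ V * 2 := by
      rw [abs_mul, abs_of_pos (Real.exp_pos _)]
      calc Real.exp (-(k * s x)) * |A x|
          ≤ Real.exp (-(k * s x)) * (Real.exp (k * s x) * V * |x - (-1)|) := by gcongr
        _ = V * |x - (-1)| := by linear_combination (V * |x - (-1)|) * hee
        _ ≤ V * 2 := by gcongr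
    have h4 : |Real.exp (k * s x) * B x| ≤ V * 2 := by
      rw [abs_mul, abs_of_pos (Real.exp_pos _)]
      calc Real.exp (k * s x) * |B x|
          ≤ Real.exp (k * s x) * (Real.exp (-(k * s x)) * V * |1 - x|) := by gcongr
        _ = V * |1 - x| := by linear_combination (V * |1 - x|) * hee
        _ ≤ V * 2 := by gcongr
    rw [abs_le] at *
    constructor <;> linarith [h3.1, h3.2, h4.1, h4.2]
  · have h1 := ((hE'.mul hA').add (hE.mul hB')).div_const (2 * k)
    refine (h1.congr_of_eventuallyEq ?_).congr_deriv ?_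
    · filter_upwards [isOpen_Ioo.mem_nhds hx] with z hz
      exact hw z hz
    · simp only [ha, hb]
      field_simp
      ring
  · have h1 := ((hE'.mul hA').fun_neg.add (hE.mul hB')).div_const 2
    refine h1.congr_deriv ?_
    rw [hw x hx]
    simp only [ha, hb]
    field_simp
    linear_combination (-2 * v x * f x) * hee

end IsArc

/-- `M` is the largest eigenvalue of the Green operator, attained by a continuous eigenfunction. -/
structure IsTopGreenEigenvalue (s : ℝ → ℝ) (k M : ℝ) : Prop where
  pos : 0 < M
  exists_eigenfunction : ∃ w : ℝ → ℝ, Continuous w ∧ (∃ x ∈ Ioo (-1 : ℝ) 1, w x ≠ 0) ∧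
    ∀ x ∈ Icc (-1 : ℝ) 1, ∫ y in (-1 : ℝ)..1, greenKernel s k x y * w y = M * w x
  rayleigh_le : ∀ v : ℝ → ℝ, Continuous v →
    ∫ x in (-1 : ℝ)..1, (∫ y in (-1 : ℝ)..1, greenKernel s k x y * v y) * v x
      ≤ M * ∫ x in (-1 : ℝ)..1, v x ^ 2

theorem integral_subtype_Icc (g : ℝ → ℝ) :
    ∫ x : Icc (-1 : ℝ) 1, g x ∂(volume.comap Subtype.val) = ∫ x in (-1 : ℝ)..1, g x := by
  rw [integral_subtype_comap measurableSet_Icc, integral_of_le (by norm_num),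
    integral_Icc_eq_integral_Ioc]

namespace IsArc

variable {f s : ℝ → ℝ}

theorem exists_isTopGreenEigenvalue (hs : IsArc f s) {k : ℝ} (hk : 0 < k) :
    ∃ M, IsTopGreenEigenvalue s k M := by
  let μ : Measure (Icc (-1 : ℝ) 1) := volume.comap Subtype.val
  have hμ : IsFiniteMeasure μ := by
    refine ⟨?_⟩
    rw [(MeasurableEmbedding.subtype_coe measurableSet_Icc).comap_apply, image_univ,
      Subtype.range_coe]
    exact measure_Icc_lt_top
  let G : Icc (-1 : ℝ) 1 → Icc (-1 : ℝ) 1 → ℝ := fun x y => greenKernel s k x y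
  have hae : ∀ᵐ y : Icc (-1 : ℝ) 1 ∂μ, (y : ℝ) ∈ Ioo (-1 : ℝ) 1 := by
    have h1 : ∀ᵐ y : ℝ, y ≠ 1 := Measure.ae_ne volume 1
    have h2 : ∀ᵐ y : ℝ, y ≠ -1 := Measure.ae_ne volume (-1)
    have h3 : ∀ᵐ y : ℝ ∂volume.restrict (Icc (-1) 1), y ∈ Ioo (-1 : ℝ) 1 := by
      rw [ae_restrict_iff' measurableSet_Icc]
      filter_upwards [h1, h2] with y hy1 hy2 hy
      exact ⟨lt_of_le_of_ne hy.1 hy2.symm, lt_of_le_of_ne hy.2 hy1⟩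
    rw [← map_comap_subtype_coe measurableSet_Icc] at h3
    exact ae_of_ae_map measurable_subtype_coe.aemeasurable h3
  have hpos : 0 < ∫ x, ∫ y, G x y ∂μ ∂μ := by
    have h1 : ∀ x : Icc (-1 : ℝ) 1, ∫ y, G x y ∂μ
        = ∫ y in (-1 : ℝ)..1, greenKernel s k x y * 1 := by
      intro x
      simp only [mul_one]
      exact integral_subtype_Icc (fun y => greenKernel s k x y)
    simp only [h1]
    rw [integral_subtype_Icc (fun x => ∫ y in (-1 : ℝ)..1, greenKernel s k x y * 1)]
    have hc := hs.continuousOn_integral_greenKernel hk (v := fun _ => 1) continuous_const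
    refine integral_pos (by norm_num) hc (fun x hx => ?_) ⟨0, by norm_num, ?_⟩
    · exact integral_nonneg (by norm_num) fun y _ => by
        simpa using greenKernel_nonneg hk x y
    · refine intervalIntegral_pos_of_pos_on
        (hs.intervalIntegrable_greenKernel_mul hk continuous_const 0 (-1) 1) (fun y hy => ?_)
        (by norm_num)
      rw [greenKernel_of_mem (by norm_num) hy]
      positivity
  obtain ⟨M, hM, ⟨w, hw0, hw⟩, hmax⟩ := exists_kernel_eigenfunction (μ := μ) G
    ((measurable_greenKernel hs.measurable k).comp
      (measurable_subtype_coe.prodMap measurable_subtype_coe))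
    (fun x y => abs_greenKernel_le hk x y) (fun x y => greenKernel_comm s k x y)
    (hae.mono fun y hy => (hs.continuousOn_greenKernel hk hy).domRestrict) hpos
  have hle : (-1 : ℝ) ≤ 1 := by norm_num
  have heig : ∀ x ∈ Icc (-1 : ℝ) 1,
      ∫ y in (-1 : ℝ)..1, greenKernel s k x y * IccExtend hle w y = M * IccExtend hle w x := by
    intro x hx
    rw [IccExtend_of_mem hle w hx, ← hw ⟨x, hx⟩, ← integral_subtype_Icc]
    simp only [IccExtend_val]
    rfl
  refine ⟨M, hM, ⟨IccExtend hle w, w.continuous.Icc_extend', ?_, heig⟩, fun v hv => ?_⟩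
  · obtain ⟨⟨x, hx⟩, hwx⟩ : ∃ x, w x ≠ 0 := by
      by_contra! h
      exact hw0 (ContinuousMap.ext h)
    rw [← IccExtend_of_mem hle w hx] at hwx
    refine ⟨x, ⟨lt_of_le_of_ne hx.1 ?_, lt_of_le_of_ne hx.2 ?_⟩, hwx⟩
    · rintro rfl
      have := heig (-1) hx
      simp only [greenKernel_neg_one, zero_mul, intervalIntegral.integral_zero] at this
      exact mul_ne_zero hM.ne' hwx this.symm
    · rintro rfl
      have := heig 1 hx
      simp only [greenKernel_one, zero_mul, intervalIntegral.integral_zero] at this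
      exact mul_ne_zero hM.ne' hwx this.symm
  · have h1 := hmax ⟨fun x => v x, hv.comp continuous_subtype_val⟩
    simp only [ContinuousMap.coe_mk] at h1
    have h2 : ∀ x : Icc (-1 : ℝ) 1, ∫ y : Icc (-1 : ℝ) 1, G x y * v y ∂μ
        = ∫ y in (-1 : ℝ)..1, greenKernel s k x y * v y := fun x =>
      integral_subtype_Icc (fun y => greenKernel s k x y * v y)
    simp only [h2] at h1
    rwa [integral_subtype_Icc (fun x => (∫ y in (-1 : ℝ)..1, greenKernel s k x y * v y) * v x),
      integral_subtype_Icc (fun x => v x ^ 2)] at h1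

theorem topGreenEigenvalue_lt (hs : IsArc f s) {k l M N : ℝ} (hk : 0 < k) (hkl : k < l)
    (hM : IsTopGreenEigenvalue s k M) (hN : IsTopGreenEigenvalue s l N) : N < M := by
  have hl : 0 < l := hk.trans hkl
  obtain ⟨w, hw, ⟨x₀, hx₀, hwx₀⟩, heig⟩ := hN.exists_eigenfunction
  have hsq : 0 < ∫ x in (-1 : ℝ)..1, w x ^ 2 :=
    integral_pos (by norm_num) (hw.pow 2).continuousOn (fun x _ => sq_nonneg _)
      ⟨x₀, Ioo_subset_Icc_self hx₀, by positivity⟩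
  have hle : (-1 : ℝ) ≤ 1 := by norm_num
  have hcont : ∀ j : ℝ, 0 < j → ∀ v : ℝ → ℝ, Continuous v → IntervalIntegrable
      (fun x => (∫ y in (-1 : ℝ)..1, greenKernel s j x y * v y) * v x) volume (-1) 1 := by
    intro j hj v hv
    refine ContinuousOn.intervalIntegrable ?_
    rw [uIcc_of_le hle]
    exact (hs.continuousOn_integral_greenKernel hj hv).mul hv.continuousOn
  have h1 : N * ∫ x in (-1 : ℝ)..1, w x ^ 2
      = ∫ x in (-1 : ℝ)..1, (∫ y in (-1 : ℝ)..1, greenKernel s l x y * w y) * w x := by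
    rw [← intervalIntegral.integral_const_mul]
    refine integral_congr fun x hx => ?_
    rw [uIcc_of_le hle] at hx
    simp only [heig x hx]
    ring
  have h2 : ∫ x in (-1 : ℝ)..1, (∫ y in (-1 : ℝ)..1, greenKernel s l x y * w y) * w x
      ≤ ∫ x in (-1 : ℝ)..1, k / l *
        ((∫ y in (-1 : ℝ)..1, greenKernel s k x y * |w y|) * |w x|) := by
    refine integral_mono_on hle (hcont l hl w hw)
      ((hcont k hk _ hw.abs).const_mul _) fun x _ => ?_
    rw [← mul_assoc, ← intervalIntegral.integral_const_mul]
    refine (le_abs_self _).trans ?_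
    rw [abs_mul]
    gcongr
    refine (abs_integral_le_integral_abs hle).trans ?_
    refine integral_mono_on hle (hs.intervalIntegrable_greenKernel_mul hl hw x (-1) 1).abs
      ((hs.intervalIntegrable_greenKernel_mul hk hw.abs x (-1) 1).const_mul _) fun y _ => ?_
    rw [abs_mul, abs_of_nonneg (greenKernel_nonneg hl x y), ← mul_assoc]
    gcongr
    exact greenKernel_le_mul hk hkl.le x y
  have h3 := hM.rayleigh_le _ hw.abs
  simp only [sq_abs] at h3
  rw [intervalIntegral.integral_const_mul] at h2
  have h4 : N * ∫ x in (-1 : ℝ)..1, w x ^ 2 ≤ (k / l * M) * ∫ x in (-1 : ℝ)..1, w x ^ 2 := by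
    rw [h1, mul_assoc]
    exact h2.trans (by gcongr)
  have h5 : N ≤ k / l * M := le_of_mul_le_mul_right h4 hsq
  have h6 : k / l < 1 := (div_lt_one hl).2 hkl
  nlinarith [hM.pos]

end IsArc

/-- A solution of a linear first order system with smooth coefficients is smooth. -/
theorem contDiffOn_of_hasDerivAt_system {U : Set ℝ} (hU : IsOpen U) {p q u P : ℝ → ℝ}
    (hp : ContDiffOn ℝ (⊤ : ℕ∞) p U) (hq : ContDiffOn ℝ (⊤ : ℕ∞) q U)
    (hu : ∀ x ∈ U, HasDerivAt u (p x * P x) x) (hP : ∀ x ∈ U, HasDerivAt P (q x * u x) x) :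
    ContDiffOn ℝ (⊤ : ℕ∞) u U := by
  have key : ∀ n : ℕ, ContDiffOn ℝ n u U ∧ ContDiffOn ℝ n P U := by
    intro n
    induction n with
    | zero =>
      simp only [CharP.cast_eq_zero, contDiffOn_zero]
      exact ⟨fun x hx => (hu x hx).continuousAt.continuousWithinAt,
        fun x hx => (hP x hx).continuousAt.continuousWithinAt⟩
    | succ n ih =>
      push_cast
      rw [contDiffOn_succ_iff_deriv_of_isOpen hU, contDiffOn_succ_iff_deriv_of_isOpen hU]
      have hn : ((n : ℕ∞) : WithTop ℕ∞) ≤ ((⊤ : ℕ∞) : WithTop ℕ∞) := by exact_mod_cast le_top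
      refine ⟨⟨fun x hx => (hu x hx).differentiableAt.differentiableWithinAt, by simp, ?_⟩,
        ⟨fun x hx => (hP x hx).differentiableAt.differentiableWithinAt, by simp, ?_⟩⟩
      · exact ((hp.of_le hn).mul ih.2).congr fun x hx => (hu x hx).deriv
      · exact ((hq.of_le hn).mul ih.1).congr fun x hx => (hP x hx).deriv
  exact contDiffOn_infty.2 fun n => (key n).1

theorem IsTopGreenEigenvalue.inv_mem_Spec {f s : ℝ → ℝ} (hf : IsProfile f) (hs : IsArc f s)
    {k : ℕ} (hk : 1 ≤ k) {M : ℝ} (hM : IsTopGreenEigenvalue s k M) : M⁻¹ ∈ Spec f k := by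
  have hk' : (0 : ℝ) < k := by exact_mod_cast hk
  have hM0 := hM.pos.ne'
  obtain ⟨w, hw, hne, heig⟩ := hM.exists_eigenfunction
  obtain ⟨P, B, hP⟩ := hs.exists_flux hf.pos hk' hw
  have hud : ∀ x ∈ Ioo (-1 : ℝ) 1, HasDerivAt w ((f x)⁻¹ * (M⁻¹ * P x)) x := by
    intro x hx
    have h1 := (hP x hx).2.1.const_mul M⁻¹
    refine (h1.congr_of_eventuallyEq ?_).congr_deriv ?_
    · filter_upwards [isOpen_Ioo.mem_nhds hx] with z hz
      rw [heig z (Ioo_subset_Icc_self hz)]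
      field_simp
    · field_simp
  have hPd : ∀ x ∈ Ioo (-1 : ℝ) 1,
      HasDerivAt (fun x => M⁻¹ * P x) (((k : ℝ) ^ 2 * (f x)⁻¹ - M⁻¹) * w x) x := by
    intro x hx
    refine ((hP x hx).2.2.const_mul M⁻¹).congr_deriv ?_
    rw [heig x (Ioo_subset_Icc_self hx)]
    field_simp
  have hinv : ContDiffOn ℝ (⊤ : ℕ∞) (fun x => (f x)⁻¹) (Ioo (-1) 1) :=
    hf.smoothOn.inv fun x hx => (hf.pos x hx).ne'
  refine ⟨w, hw.continuousOn, ?_, hne, fun _ => ⟨?_, ?_⟩, fun x hx => ?_⟩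
  · exact contDiffOn_of_hasDerivAt_system isOpen_Ioo hinv
      ((contDiffOn_const.mul hinv).sub contDiffOn_const) hud hPd
  · have := heig (-1) (by norm_num)
    simp only [greenKernel_neg_one, zero_mul, intervalIntegral.integral_zero] at this
    exact (mul_eq_zero.1 this.symm).resolve_left hM0
  · have := heig 1 (by norm_num)
    simp only [greenKernel_one, zero_mul, intervalIntegral.integral_zero] at this
    exact (mul_eq_zero.1 this.symm).resolve_left hM0
  · have h1 : (fun y => f y * deriv w y) =ᶠ[𝓝 x] fun y => M⁻¹ * P y := by
      filter_upwards [isOpen_Ioo.mem_nhds hx] with z hz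
      rw [(hud z hz).deriv, mul_inv_cancel_left₀ (hf.pos z hz).ne']
    rw [h1.deriv_eq, (hPd x hx).deriv]
    ring

theorem zero_mem_Spec_zero (f : ℝ → ℝ) : (0 : ℝ) ∈ Spec f 0 :=
  ⟨fun _ => 1, continuousOn_const, contDiffOn_const, ⟨0, by norm_num⟩, by simp, by simp⟩

/-- `√f` as a test function bounds the top eigenvalue of the Green operator from below. -/
theorem IsTopGreenEigenvalue.inv_mul_integral_le {f s : ℝ → ℝ} (hf : IsProfile f)
    (hf' : ContinuousOn (deriv f) (Icc (-1) 1)) (hs : IsArc f s) {k M : ℝ} (hk : 0 < k)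
    (hM : IsTopGreenEigenvalue s k M) :
    M⁻¹ * ∫ x in (-1 : ℝ)..1, f x ≤ 2 * k ^ 2 + ∫ x in (-1 : ℝ)..1, deriv f x ^ 2 / 4 := by
  have hle : (-1 : ℝ) ≤ 1 := by norm_num
  have hfnn : ∀ x ∈ Icc (-1 : ℝ) 1, 0 ≤ f x := by
    intro x hx
    rcases eq_or_lt_of_le hx.1 with rfl | h1
    · exact hf.zero_neg_one.ge
    rcases eq_or_lt_of_le hx.2 with rfl | h2
    · exact hf.zero_one.ge
    · exact (hf.pos x ⟨h1, h2⟩).le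
  obtain ⟨v, hv, hvf⟩ : ∃ v : ℝ → ℝ, Continuous v ∧ ∀ x ∈ Icc (-1 : ℝ) 1, v x = √(f x) :=
    ⟨IccExtend hle (domRestrict (Icc (-1) 1) fun x => √(f x)),
      (continuousOn_iff_continuous_domRestrict.1 hf.contOn.sqrt).Icc_extend',
      fun x hx => IccExtend_of_mem hle _ hx⟩
  have hv2 : ∀ x ∈ Icc (-1 : ℝ) 1, v x ^ 2 = f x := fun x hx => by
    rw [hvf x hx, Real.sq_sqrt (hfnn x hx)]
  obtain ⟨P, B, hP⟩ := hs.exists_flux hf.pos hk hv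
  set w : ℝ → ℝ := fun x => ∫ y in (-1 : ℝ)..1, greenKernel s k x y * v y with hw
  have hwc : ContinuousOn w (Icc (-1) 1) := hs.continuousOn_integral_greenKernel hk hv
  have hw1 : w 1 = 0 := by simp [hw, greenKernel_one]
  have hw2 : w (-1) = 0 := by simp [hw, greenKernel_neg_one]
  have hv1 : v 1 = 0 := by rw [hvf 1 (by norm_num), hf.zero_one, Real.sqrt_zero]
  have hv1' : v (-1) = 0 := by rw [hvf (-1) (by norm_num), hf.zero_neg_one, Real.sqrt_zero]
  set c : ℝ := M⁻¹ with hc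
  set z : ℝ → ℝ := fun x => 2 * c * v x - c ^ 2 * w x with hz
  have hzc : ContinuousOn z (Icc (-1) 1) :=
    (hv.continuousOn.const_mul _).sub (hwc.const_mul _)
  have hz1 : z 1 = 0 := by simp [hz, hw1, hv1]
  have hz2 : z (-1) = 0 := by simp [hz, hw2, hv1']
  have hB : 0 ≤ B := (abs_nonneg _).trans (hP 0 (by norm_num)).1
  have hPle : ∀ x ∈ Icc (-1 : ℝ) 1, ‖P x * z x‖ ≤ B * ‖z x‖ := by
    intro x hx
    rcases eq_or_lt_of_le hx.1 with rfl | h1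
    · simp [hz2]
    rcases eq_or_lt_of_le hx.2 with rfl | h2
    · simp [hz1]
    · rw [norm_mul]
      gcongr
      exact (hP x ⟨h1, h2⟩).1
  have hvd : ∀ x ∈ Ioo (-1 : ℝ) 1, HasDerivAt v (deriv f x / (2 * √(f x))) x := by
    intro x hx
    have h1 := (hf.differentiableAt hx).hasDerivAt.sqrt (hf.pos x hx).ne'
    refine h1.congr_of_eventuallyEq ?_
    filter_upwards [isOpen_Ioo.mem_nhds hx] with y hy
    exact hvf y (Ioo_subset_Icc_self hy)
  have hHd : ∀ x ∈ Ioo (-1 : ℝ) 1, HasDerivAt (fun x => P x * z x)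
      ((k ^ 2 / f x * w x - v x) * z x
        + P x * (2 * c * (deriv f x / (2 * √(f x))) - c ^ 2 * (P x / f x))) x := by
    intro x hx
    exact (hP x hx).2.2.mul (((hvd x hx).const_mul (2 * c)).sub ((hP x hx).2.1.const_mul (c ^ 2)))
  have hHc : ContinuousOn (fun x => P x * z x) (Icc (-1) 1) := by
    have hend : ∀ x ∈ Icc (-1 : ℝ) 1, z x = 0 →
        ContinuousWithinAt (fun x => P x * z x) (Icc (-1) 1) x := by
      intro x hx hzx
      rw [ContinuousWithinAt, hzx, mul_zero]
      refine squeeze_zero_norm' (a := fun x => B * ‖z x‖) ?_ ?_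
      · filter_upwards [self_mem_nhdsWithin] with y hy
        exact hPle y hy
      · have := ((hzc x hx).norm.const_mul B)
        simpa [ContinuousWithinAt, hzx] using this
    intro x hx
    rcases eq_or_lt_of_le hx.1 with rfl | h1
    · exact hend _ hx hz2
    rcases eq_or_lt_of_le hx.2 with rfl | h2
    · exact hend _ hx hz1
    · exact (hHd x ⟨h1, h2⟩).continuousAt.continuousWithinAt
  set F : ℝ := ∫ x in (-1 : ℝ)..1, f x with hF
  have hi1 : IntervalIntegrable (fun x => deriv f x ^ 2 / 4) volume (-1) 1 := by
    refine ContinuousOn.intervalIntegrable ?_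
    rw [uIcc_of_le hle]
    exact (hf'.pow 2).div_const 4
  have hi2 : IntervalIntegrable f volume (-1) 1 := by
    refine ContinuousOn.intervalIntegrable ?_
    rw [uIcc_of_le hle]
    exact hf.contOn
  have hi3 : IntervalIntegrable (fun x => w x * v x) volume (-1) 1 := by
    refine ContinuousOn.intervalIntegrable ?_
    rw [uIcc_of_le hle]
    exact hwc.mul hv.continuousOn
  have hi4 : IntervalIntegrable (fun x => deriv f x ^ 2 / 4 + k ^ 2 - 2 * c * f x) volume (-1) 1 :=
    (hi1.add intervalIntegrable_const).sub (hi2.const_mul _)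
  have hφ : IntervalIntegrable
      (fun x => deriv f x ^ 2 / 4 + k ^ 2 - 2 * c * f x + c ^ 2 * (w x * v x)) volume (-1) 1 :=
    hi4.add (hi3.const_mul _)
  have hmain := sub_le_integral_of_hasDeriv_right_of_le hle hHc
    (fun x hx => (hHd x hx).hasDerivWithinAt)
    ((intervalIntegrable_iff_integrableOn_Icc_of_le hle).1 hφ) (fun x hx => by
      have hfx := hf.pos x hx
      have hsf : 0 < √(f x) := Real.sqrt_pos.2 hfx
      have hsq : √(f x) ^ 2 = f x := Real.sq_sqrt hfx.le
      have h0 : 0 ≤ (deriv f x / 2 - c * P x / √(f x)) ^ 2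
          + k ^ 2 * (1 - c * w x / √(f x)) ^ 2 := by
        positivity
      refine le_of_sub_nonneg (h0.trans_eq ?_)
      simp only [hz, hvf x (Ioo_subset_Icc_self hx)]
      rw [← hsq]
      simp only [Real.sqrt_sq hsf.le]
      field_simp
      ring)
  rw [hz1, hz2, mul_zero, mul_zero, sub_zero, integral_add hi4 (hi3.const_mul _),
    integral_sub (hi1.add intervalIntegrable_const) (hi2.const_mul _),
    integral_add hi1 intervalIntegrable_const, intervalIntegral.integral_const_mul,
    intervalIntegral.integral_const_mul, intervalIntegral.integral_const] at hmain
  have hray := hM.rayleigh_le v hv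
  have hvF : ∫ x in (-1 : ℝ)..1, v x ^ 2 = F := by
    refine integral_congr fun x hx => ?_
    rw [uIcc_of_le hle] at hx
    exact hv2 x hx
  rw [hvF] at hray
  have h5 : c ^ 2 * ∫ x in (-1 : ℝ)..1, w x * v x ≤ c ^ 2 * (M * F) := by gcongr
  have h6 : c ^ 2 * (M * F) = c * F := by
    rw [hc]
    have := hM.pos.ne'
    field_simp
  rw [smul_eq_mul] at hmain
  linarith

theorem IsProfile.integral_deriv_sq {f : ℝ → ℝ} (hf : IsProfile f)
    (hf' : ContinuousOn (deriv f) (Icc (-1) 1))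
    (hint : IntervalIntegrable (fun x => f x * deriv (deriv f) x) volume (-1) 1) :
    ∫ x in (-1 : ℝ)..1, deriv f x ^ 2 / 4
      = (∫ x in (-1 : ℝ)..1, f x * (-(deriv (deriv f) x) / 2)) / 2 := by
  have hle : (-1 : ℝ) ≤ 1 := by norm_num
  have hi1 : IntervalIntegrable (fun x => deriv f x ^ 2) volume (-1) 1 := by
    refine ContinuousOn.intervalIntegrable ?_
    rw [uIcc_of_le hle]
    exact hf'.pow 2
  have h1 : ∫ x in (-1 : ℝ)..1, (deriv f x ^ 2 + f x * deriv (deriv f) x)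
      = f 1 * deriv f 1 - f (-1) * deriv f (-1) := by
    refine integral_eq_sub_of_hasDerivAt_of_le hle (f := fun x => f x * deriv f x)
      (hf.contOn.mul hf') (fun x hx => ?_) (hi1.add hint)
    have h2 : ContDiffOn ℝ (⊤ : ℕ∞) (deriv f) (Ioo (-1) 1) :=
      hf.smoothOn.deriv_of_isOpen isOpen_Ioo (by simp)
    have h3 := ((h2.differentiableOn (by simp)).differentiableAt
      (isOpen_Ioo.mem_nhds hx)).hasDerivAt
    exact ((hf.differentiableAt hx).hasDerivAt.mul h3).congr_deriv (by ring)
  rw [hf.zero_one, hf.zero_neg_one, zero_mul, zero_mul, sub_zero, integral_add hi1 hint] at h1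
  have h4 : ∫ x in (-1 : ℝ)..1, f x * (-(deriv (deriv f) x) / 2)
      = (-1 / 2) * ∫ x in (-1 : ℝ)..1, f x * deriv (deriv f) x := by
    rw [← intervalIntegral.integral_const_mul]
    congr 1
    ext x
    ring
  rw [h4, intervalIntegral.integral_div]
  linarith

/-- If `∫ f ≥ 2` then `λ_m ≤ m² + (∫ f K)/(2 ∫ f)`; consequently `λ_m < m² + m`
for large `m` and `(m² + m) - λ_m → ∞`. -/
theorem eigenvalues_diverge_below_round (f : ℝ → ℝ) (hf : IsProfile f)
    (hf' : ContinuousOn (deriv f) (Icc (-1) 1))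
    (hint : IntervalIntegrable (fun x => f x * deriv (deriv f) x) volume (-1) 1)
    (Λ : ℕ → ℝ) (hΛmono : StrictMono Λ) (hΛrange : Set.range Λ = Eigs f)
    (harea : 2 ≤ ∫ x in (-1:ℝ)..1, f x) :
    (∀ m : ℕ, 1 ≤ m →
      Λ m ≤ (m:ℝ)^2 + (∫ x in (-1:ℝ)..1, f x * (-(deriv (deriv f) x) / 2))
        / (2 * ∫ x in (-1:ℝ)..1, f x)) ∧
    (∀ᶠ m : ℕ in atTop, Λ m < (m:ℝ)^2 + (m:ℝ)) ∧
    Tendsto (fun m : ℕ => ((m:ℝ)^2 + (m:ℝ)) - Λ m) atTop atTop := by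
  set F : ℝ := ∫ x in (-1 : ℝ)..1, f x with hF
  set K : ℝ := ∫ x in (-1 : ℝ)..1, f x * (-(deriv (deriv f) x) / 2) with hK
  obtain ⟨s, hs⟩ := hf.exists_isArc
  have hex : ∀ k : ℕ, ∃ M, IsTopGreenEigenvalue s ((k : ℝ) + 1) M := fun k =>
    hs.exists_isTopGreenEigenvalue (by positivity)
  choose M hM using hex
  let lam : ℕ → ℝ := fun m => Nat.casesOn m 0 fun k => (M k)⁻¹
  have hlam_mono : StrictMono lam := by
    refine strictMono_nat_of_lt_succ fun m => ?_
    cases m with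
    | zero => exact inv_pos.2 (hM 0).pos
    | succ k =>
      refine inv_strictAnti₀ (hM (k + 1)).pos ?_
      exact hs.topGreenEigenvalue_lt (by positivity) (by push_cast; linarith) (hM k) (hM (k + 1))
  have hlam_mem : ∀ m, ∃ j, Λ j = lam m := by
    intro m
    have h1 : lam m ∈ Eigs f := by
      refine mem_iUnion.2 ⟨m, ?_⟩
      cases m with
      | zero => exact zero_mem_Spec_zero f
      | succ k =>
        refine IsTopGreenEigenvalue.inv_mem_Spec hf hs (by omega) ?_
        exact_mod_cast hM k
    rwa [← hΛrange] at h1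
  choose g hg using hlam_mem
  have hgmono : StrictMono g := fun a b hab => by
    rw [← hΛmono.lt_iff_lt, hg, hg]
    exact hlam_mono hab
  have hbound : ∀ m : ℕ, 1 ≤ m → Λ m ≤ (m : ℝ) ^ 2 + K / (2 * F) := by
    intro m hm
    have h1 : Λ m ≤ lam m := by
      rw [← hg m]
      exact hΛmono.monotone (hgmono.le_apply)
    refine h1.trans ?_
    obtain ⟨k, rfl⟩ : ∃ k, m = k + 1 := ⟨m - 1, by omega⟩
    have h2 := (hM k).inv_mul_integral_le hf hf' hs (by positivity)
    rw [hf.integral_deriv_sq hf' hint, ← hF, ← hK] at h2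
    have hFpos : 0 < F := by linarith
    have h3 : (M k)⁻¹ ≤ (2 * ((k : ℝ) + 1) ^ 2 + K / 2) / F := (le_div_iff₀ hFpos).2 h2
    have h4 : (2 * ((k : ℝ) + 1) ^ 2) / F ≤ ((k : ℝ) + 1) ^ 2 := by
      rw [div_le_iff₀ hFpos]
      nlinarith [sq_nonneg ((k : ℝ) + 1)]
    have h5 : K / 2 / F = K / (2 * F) := by rw [div_div]
    rw [add_div, h5] at h3
    push_cast
    exact h3.trans (by linarith)
  have htend : Tendsto (fun m : ℕ => ((m : ℝ) ^ 2 + (m : ℝ)) - Λ m) atTop atTop := by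
    have h1 : Tendsto (fun m : ℕ => (m : ℝ) + -(K / (2 * F))) atTop atTop :=
      tendsto_atTop_add_const_right _ _ tendsto_natCast_atTop_atTop
    refine tendsto_atTop_mono' _ ?_ h1
    filter_upwards [eventually_ge_atTop 1] with m hm
    linarith [hbound m hm]
  refine ⟨hbound, ?_, htend⟩
  filter_upwards [htend.eventually_gt_atTop 0] with m hm
  linarith
end

section
/- Define f : ℝ → ℝ by f(x) = 2(1-x²)/(1+x²), and let Λ : ℕ → ℝ be the strictly increasing enumeration of E(f) = ⋃_{k ≥ 0} Spec L_k. Then for every m ≥ 1, Λ(m) ≤ m²/(π-2) + (3π+4)/(12π-24), and consequently Λ(m) < m² + 1 for every m ∈ ℕ (so every distinct eigenvalue is strictly less than the corresponding eigenvalue bound m² + 1, even though this metric has negative curvature on the polar regions |x| > 1/√3). -/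
open Set MeasureTheory intervalIntegral Filter

/-- For a compact symmetric operator `T ≠ 0`, if the absolute values of the quadratic form are
dominated by its values on a closed set `C`, then `‖T‖` is an eigenvalue with a unit
eigenvector in `C`. -/
theorem exists_unit_eigenvector_mem_of_isCompactOperator {H : Type*} [NormedAddCommGroup H]
    [InnerProductSpace ℝ H] {T : H →L[ℝ] H} (hcomp : IsCompactOperator T)
    (hsymm : (T : H →ₗ[ℝ] H).IsSymmetric) (hT : T ≠ 0) {C : Set H} (hC : IsClosed C)
    (hdom : ∀ u, ∃ v ∈ C, ‖v‖ = ‖u‖ ∧ |inner ℝ (T u) u| ≤ inner ℝ (T v) v) :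
    ∃ u ∈ C, ‖u‖ = 1 ∧ T u = ‖T‖ • u := by
  have hM : 0 < ‖T‖ := norm_pos_iff.mpr hT
  have hseq : ∀ n : ℕ, ∃ v ∈ C, ‖v‖ = 1 ∧ ‖T‖ - ‖T‖ / ((n : ℝ) + 1) < inner ℝ (T v) v := by
    intro n
    have hlt : ‖T‖ - ‖T‖ / ((n : ℝ) + 1) < ⨆ x, |T.rayleighQuotient x| := by
      rw [← ContinuousLinearMap.norm_eq_iSup_rayleighQuotient T hsymm]
      have : 0 < ‖T‖ / ((n : ℝ) + 1) := by positivity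
      linarith
    obtain ⟨x, hx⟩ := exists_lt_of_lt_ciSup hlt
    have hnonneg : 0 ≤ ‖T‖ - ‖T‖ / ((n : ℝ) + 1) := by
      have : ‖T‖ / ((n : ℝ) + 1) ≤ ‖T‖ := div_le_self hM.le (by linarith [n.cast_nonneg (α := ℝ)])
      linarith
    have hx0 : x ≠ 0 := by
      rintro rfl
      simp at hx
      linarith
    have hxn : 0 < ‖x‖ := norm_pos_iff.mpr hx0
    obtain ⟨v, hv, hvn, hvT⟩ := hdom (‖x‖⁻¹ • x)
    refine ⟨v, hv, ?_, hx.trans_le (le_trans (le_of_eq ?_) hvT)⟩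
    · rw [hvn, norm_smul, norm_inv, norm_norm, inv_mul_cancel₀ hxn.ne']
    · rw [ContinuousLinearMap.rayleighQuotient, ContinuousLinearMap.reApplyInnerSelf_apply]
      simp only [map_smul, inner_smul_left, inner_smul_right]
      congr 1
      simp
      field_simp
  choose v hvC hvn hvT using hseq
  obtain ⟨K, hK, hTK⟩ := hcomp.image_closedBall_subset_compact (f := (T : H →ₗ[ℝ] H)) 1
  obtain ⟨w, -, φ, hφ, hw⟩ := hK.tendsto_subseq (x := fun n => T (v n))
    fun n => hTK ⟨v n, by simp [hvn n], rfl⟩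
  have hsmall : Tendsto (fun n => T (v n) - ‖T‖ • v n) atTop (nhds 0) := by
    have hsq : Tendsto (fun n : ℕ => 2 * ‖T‖ ^ 2 * (1 / ((n : ℝ) + 1))) atTop (nhds 0) := by
      have h := (tendsto_one_div_add_atTop_nhds_zero_nat (𝕜 := ℝ)).const_mul (2 * ‖T‖ ^ 2)
      rwa [mul_zero] at h
    rw [tendsto_zero_iff_norm_tendsto_zero]
    have hsqrt := hsq.sqrt
    rw [Real.sqrt_zero] at hsqrt
    refine squeeze_zero (fun _ => norm_nonneg _) (fun n => ?_) hsqrt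
    refine Real.le_sqrt_of_sq_le ?_
    rw [norm_sub_sq_real, norm_smul, hvn, inner_smul_right]
    have h1 : ‖T (v n)‖ ≤ ‖T‖ := by simpa [hvn] using T.le_opNorm (v n)
    have h2 : ‖T (v n)‖ ^ 2 ≤ ‖T‖ ^ 2 := by gcongr
    have h3 := mul_le_mul_of_nonneg_left (hvT n).le hM.le
    have h4 : ‖T‖ * (‖T‖ - ‖T‖ / ((n : ℝ) + 1)) = ‖T‖ ^ 2 - ‖T‖ ^ 2 * (1 / ((n : ℝ) + 1)) := by
      ring
    rw [norm_norm, mul_one]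
    linarith
  have hv : Tendsto (fun n => v (φ n)) atTop (nhds (‖T‖⁻¹ • w)) := by
    have := (hw.sub (hsmall.comp hφ.tendsto_atTop)).const_smul ‖T‖⁻¹
    simpa [Function.comp_def, smul_smul, inv_mul_cancel₀ hM.ne'] using this
  refine ⟨‖T‖⁻¹ • w, hC.mem_of_tendsto hv (Eventually.of_forall fun n => hvC _), ?_, ?_⟩
  · exact tendsto_nhds_unique hv.norm (by simp [hvn])
  · have h1 := (T.continuous.tendsto _).comp hv
    rw [smul_smul, mul_inv_cancel₀ hM.ne', one_smul]
    exact tendsto_nhds_unique h1 hw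

/-- The operator sending a vector `u` of a Hilbert space to the function `x ↦ ⟪g x, u⟫`, for a
continuous family `g` of vectors indexed by a compact space. -/
noncomputable def innerFamily {X H : Type*} [TopologicalSpace X] [CompactSpace X]
    [NormedAddCommGroup H] [InnerProductSpace ℝ H] (g : C(X, H)) :
    H →L[ℝ] BoundedContinuousFunction X ℝ :=
  LinearMap.mkContinuous
    { toFun := fun u => BoundedContinuousFunction.mkOfCompact
        ⟨fun x => inner ℝ (g x) u, by fun_prop⟩
      map_add' := fun u v => by ext x; simp [inner_add_right]
      map_smul' := fun c u => by ext x; simp [inner_smul_right] }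
    ‖g‖ (fun u => by
      refine (BoundedContinuousFunction.norm_le (by positivity)).mpr fun x => ?_
      refine (norm_inner_le_norm _ _).trans ?_
      gcongr
      exact g.norm_coe_le_norm x)

theorem innerFamily_apply {X H : Type*} [TopologicalSpace X] [CompactSpace X]
    [NormedAddCommGroup H] [InnerProductSpace ℝ H] (g : C(X, H)) (u : H) (x : X) :
    innerFamily g u x = inner ℝ (g x) u := rfl

theorem isCompactOperator_innerFamily {X H : Type*} [TopologicalSpace X] [CompactSpace X]
    [NormedAddCommGroup H] [InnerProductSpace ℝ H] (g : C(X, H)) :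
    IsCompactOperator (innerFamily g) := by
  refine (isCompactOperator_iff_isCompact_closure_image_closedBall
    (innerFamily g : H →ₗ[ℝ] BoundedContinuousFunction X ℝ) one_pos).mpr ?_
  refine BoundedContinuousFunction.arzela_ascoli (Metric.closedBall 0 ‖g‖)
    (isCompact_closedBall _ _) _ ?_ ?_
  · rintro _ x ⟨u, hu, rfl⟩
    rw [mem_closedBall_zero_iff] at hu ⊢
    refine (norm_inner_le_norm _ _).trans ?_
    have := mul_le_mul (g.norm_coe_le_norm x) hu (norm_nonneg _) (norm_nonneg _)
    simpa using this
  · intro x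
    rw [Metric.equicontinuousAt_iff_right]
    intro ε hε
    filter_upwards [Metric.tendsto_nhds.mp (g.continuous.tendsto x) ε hε] with y hy
    rintro ⟨_, u, hu, rfl⟩
    rw [mem_closedBall_zero_iff] at hu
    rw [dist_comm] at hy
    refine lt_of_le_of_lt ?_ hy
    change dist (inner ℝ (g x) u) (inner ℝ (g y) u) ≤ _
    rw [dist_eq_norm, dist_eq_norm, ← inner_sub_left]
    refine (norm_inner_le_norm _ _).trans ?_
    exact mul_le_of_le_one_right (norm_nonneg _) hu

/-- A bounded symmetric positive kernel on a compact space of finite measure, continuous in its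
first variable, has a positive continuous eigenfunction. -/
theorem exists_pos_eigenfunction_of_kernel {X : Type*} [TopologicalSpace X] [CompactSpace X]
    [SecondCountableTopology X] [MeasurableSpace X] [BorelSpace X] {μ : Measure X}
    [IsFiniteMeasure μ] [NeZero μ] {K : X → X → ℝ} (hmeas : Measurable (Function.uncurry K))
    (hnonneg : ∀ x y, 0 ≤ K x y) (hle : ∀ x y, K x y ≤ 1) (hsymm : ∀ x y, K x y = K y x)
    (hcont : ∀ᵐ y ∂μ, Continuous fun x => K x y) (hpos : ∀ᵐ x ∂μ, ∀ᵐ y ∂μ, 0 < K x y) :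
    ∃ M > 0, ∃ u : X → ℝ, Continuous u ∧ (∀ x, 0 ≤ u x) ∧
      (∀ x, (∀ᵐ y ∂μ, 0 < K x y) → 0 < u x) ∧ ∀ x, ∫ y, K x y * u y ∂μ = M * u x := by
  have hKm : ∀ x, Measurable (K x) := fun x => hmeas.comp measurable_prodMk_left
  have hKb : ∀ x y, ‖K x y‖ ≤ 1 := fun x y => by
    rw [Real.norm_of_nonneg (hnonneg x y)]; exact hle x y
  have hL2 : ∀ x, MemLp (K x) 2 μ := fun x =>
    MemLp.of_bound (hKm x).aestronglyMeasurable 1 (Eventually.of_forall (hKb x))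
  have hgc : Continuous fun x => (hL2 x).toLp (K x) := by
    rw [continuous_iff_continuousAt]
    intro x
    rw [ContinuousAt, tendsto_iff_norm_sub_tendsto_zero]
    have hsq : Tendsto (fun z => ∫ y, (K z y - K x y) ^ 2 ∂μ) (nhds x) (nhds 0) := by
      have h := tendsto_integral_filter_of_dominated_convergence (μ := μ) (l := nhds x)
        (F := fun z y => (K z y - K x y) ^ 2) (f := fun _ => 0) (fun _ => 1)
        (Eventually.of_forall fun z => (((hKm z).sub (hKm x)).pow_const 2).aestronglyMeasurable)
        (Eventually.of_forall fun z => Eventually.of_forall fun y => by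
          rw [norm_pow, Real.norm_eq_abs]
          refine pow_le_one₀ (abs_nonneg _) (abs_le.mpr ⟨?_, ?_⟩) <;>
          linarith [hnonneg z y, hle z y, hnonneg x y, hle x y])
        (integrable_const _)
        (by
          filter_upwards [hcont] with y hy
          have := ((hy.tendsto x).sub_const (K x y)).pow 2
          simpa using this)
      simpa using h
    have hsqrt := hsq.sqrt
    rw [Real.sqrt_zero] at hsqrt
    refine hsqrt.congr fun z => ?_
    rw [← MemLp.toLp_sub (hL2 z) (hL2 x), ← Real.sqrt_sq (norm_nonneg _),
      ← real_inner_self_eq_norm_sq, L2.inner_def]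
    congr 1
    refine integral_congr_ae ?_
    filter_upwards [((hL2 z).sub (hL2 x)).coeFn_toLp] with y hy
    rw [hy]
    simp [sq]
  let g : C(X, Lp ℝ 2 μ) := ⟨fun x => (hL2 x).toLp (K x), hgc⟩
  have hA : ∀ u x, innerFamily g u x = ∫ y, K x y * u y ∂μ := by
    intro u x
    rw [innerFamily_apply, L2.inner_def]
    refine integral_congr_ae ?_
    filter_upwards [(hL2 x).coeFn_toLp] with y hy
    change inner ℝ ((hL2 x).toLp (K x) y) (u y) = _
    rw [hy]
    simp [mul_comm]
  let T : Lp ℝ 2 μ →L[ℝ] Lp ℝ 2 μ :=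
    (BoundedContinuousFunction.toLp 2 μ ℝ).comp (innerFamily g)
  have hTcoe : ∀ u, T u =ᵐ[μ] fun x => ∫ y, K x y * u y ∂μ := by
    intro u
    filter_upwards [BoundedContinuousFunction.coeFn_toLp (E := ℝ) 2 μ ℝ (innerFamily g u)] with x hx
    rw [← hA]
    exact hx
  have hcompact : IsCompactOperator T :=
    (isCompactOperator_innerFamily g).clm_comp (BoundedContinuousFunction.toLp 2 μ ℝ)
  have hint : ∀ u : Lp ℝ 2 μ, Integrable u μ := fun u => (Lp.memLp u).integrable (by norm_num)
  have hKint : ∀ (u : Lp ℝ 2 μ) x, Integrable (fun y => K x y * u y) μ := fun u x =>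
    (hint u).bdd_mul (hKm x).aestronglyMeasurable (Eventually.of_forall (hKb x))
  have hinner : ∀ u v : Lp ℝ 2 μ, inner ℝ (T u) v = ∫ x, ∫ y, K x y * u y * v x ∂μ ∂μ := by
    intro u v
    rw [L2.inner_def]
    refine integral_congr_ae ?_
    filter_upwards [hTcoe u] with x hx
    simp only [RCLike.inner_apply, conj_trivial, hx]
    rw [mul_comm, ← MeasureTheory.integral_mul_const]
  have hsymmT : (T : Lp ℝ 2 μ →ₗ[ℝ] Lp ℝ 2 μ).IsSymmetric := by
    intro u v
    change inner ℝ (T u) v = inner ℝ u (T v)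
    rw [hinner u v, real_inner_comm, hinner v u, integral_integral_swap]
    · refine integral_congr_ae (Eventually.of_forall fun x => integral_congr_ae
        (Eventually.of_forall fun y => ?_))
      simp only
      rw [hsymm y x]
      ring
    · have h := (hint u).mul_prod (hint v)
      have h' := (h.swap).bdd_mul (c := 1) hmeas.aestronglyMeasurable
        (Eventually.of_forall fun p => hKb p.1 p.2)
      refine h'.congr (Eventually.of_forall fun p => ?_)
      simp [Function.uncurry, mul_assoc]
  have hposfun : ∀ (u : Lp ℝ 2 μ), 0 ≤ u → u ≠ 0 → ∀ x, (∀ᵐ y ∂μ, 0 < K x y) →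
      0 < ∫ y, K x y * u y ∂μ := by
    intro u hu hu0 x hx
    have hu' := (Lp.coeFn_nonneg u).mpr hu
    have hnn : 0 ≤ᵐ[μ] fun y => K x y * u y := by
      filter_upwards [hu'] with y hy using mul_nonneg (hnonneg x y) hy
    refine lt_of_le_of_ne (integral_nonneg_of_ae hnn) fun h0 => hu0 ?_
    rw [eq_comm, integral_eq_zero_iff_of_nonneg_ae hnn (hKint u x)] at h0
    rw [Lp.eq_zero_iff_ae_eq_zero]
    filter_upwards [h0, hx] with y hy hy'
    exact (mul_eq_zero.mp hy).resolve_left hy'.ne'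
  have hT0 : T ≠ 0 := by
    intro hT
    let c : Lp ℝ 2 μ := (memLp_const (1 : ℝ)).toLp _
    have hc : c =ᵐ[μ] fun _ => (1 : ℝ) := (memLp_const (1 : ℝ)).coeFn_toLp
    have hc0 : 0 ≤ c := by
      rw [← Lp.coeFn_nonneg]
      filter_upwards [hc] with x hx
      simp [hx]
    have hcne : c ≠ 0 := by
      intro h
      rw [Lp.eq_zero_iff_ae_eq_zero] at h
      obtain ⟨x, hx, hx'⟩ := (h.and hc).exists
      rw [hx'] at hx
      exact one_ne_zero hx
    have hTc : T c =ᵐ[μ] 0 := by rw [hT]; exact Lp.coeFn_zero _ _ _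
    obtain ⟨x, ⟨hx, hx'⟩, hx''⟩ := ((hTc.and (hTcoe c)).and hpos).exists
    have := hposfun c hc0 hcne x hx''
    exact this.ne' (hx'.symm.trans hx)
  obtain ⟨u, hu, hu1, hTu⟩ := exists_unit_eigenvector_mem_of_isCompactOperator hcompact hsymmT hT0
    (C := {u | 0 ≤ u}) isClosed_Ici (fun u => ⟨|u|, abs_nonneg u, norm_abs_eq_norm u, by
      rw [L2.inner_def, L2.inner_def, ← Real.norm_eq_abs]
      refine norm_integral_le_of_norm_le (L2.integrable_inner _ _) ?_
      filter_upwards [hTcoe u, hTcoe |u|, Lp.coeFn_abs u] with x h1 h2 h3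
      rw [h1, h2, h3]
      simp only [RCLike.inner_apply, conj_trivial, norm_mul, Real.norm_eq_abs]
      refine mul_le_mul_of_nonneg_left ?_ (abs_nonneg _)
      rw [← Real.norm_eq_abs]
      refine norm_integral_le_of_norm_le (hKint _ x) ?_
      filter_upwards [Lp.coeFn_abs u] with y hy
      rw [hy, norm_mul, Real.norm_eq_abs, Real.norm_eq_abs, abs_of_nonneg (hnonneg x y)]⟩)
  have hM : 0 < ‖T‖ := norm_pos_iff.mpr hT0
  have hu0 : u ≠ 0 := by rintro rfl; simp at hu1
  have hu' : u =ᵐ[μ] fun x => ‖T‖⁻¹ * innerFamily g u x := by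
    have h1 : T u =ᵐ[μ] fun x => ‖T‖ * u x := by
      rw [hTu]; exact Lp.coeFn_smul _ _
    filter_upwards [h1, hTcoe u] with x hx hx'
    rw [hA, ← hx', hx]
    field_simp
  refine ⟨‖T‖, hM, fun x => ‖T‖⁻¹ * innerFamily g u x, by fun_prop, fun x => ?_, fun x hx => ?_,
    fun x => ?_⟩
  · beta_reduce
    rw [hA]
    refine mul_nonneg (inv_nonneg.mpr hM.le) (integral_nonneg_of_ae ?_)
    filter_upwards [(Lp.coeFn_nonneg u).mpr hu] with y hy using mul_nonneg (hnonneg x y) hy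
  · beta_reduce
    rw [hA]
    exact mul_pos (inv_pos.mpr hM) (hposfun u hu hu0 x hx)
  · rw [mul_inv_cancel_left₀ hM.ne', hA]
    refine integral_congr_ae ?_
    filter_upwards [hu'] with y hy
    rw [hy]

/-- The profile function `2(1-x²)/(1+x²)` of the example metric. -/
noncomputable def exampleProfile (x : ℝ) : ℝ := 2 * (1 - x ^ 2) / (1 + x ^ 2)

theorem exampleProfile_pos {x : ℝ} (hx : x ∈ Ioo (-1 : ℝ) 1) : 0 < exampleProfile x := by
  have : 0 < 1 - x ^ 2 := by nlinarith [hx.1, hx.2]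
  unfold exampleProfile
  positivity

/-- The primitive of `1 / exampleProfile` vanishing at the origin. -/
noncomputable def conformalCoord (x : ℝ) : ℝ := (Real.log (1 + x) - Real.log (1 - x) - x) / 2

theorem measurable_conformalCoord : Measurable conformalCoord := by
  unfold conformalCoord
  fun_prop

theorem contDiffOn_conformalCoord {n : WithTop ℕ∞} :
    ContDiffOn ℝ n conformalCoord (Ioo (-1) 1) := by
  unfold conformalCoord
  refine ContDiffOn.div_const (((ContDiffOn.log (by fun_prop) ?_).sub
    (ContDiffOn.log (by fun_prop) ?_)).sub contDiffOn_id) 2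
  · intro x hx
    linarith [hx.1]
  · intro x hx
    linarith [hx.2]

theorem hasDerivAt_conformalCoord {x : ℝ} (hx : x ∈ Ioo (-1 : ℝ) 1) :
    HasDerivAt conformalCoord (1 / exampleProfile x) x := by
  have h1 : 1 + x ≠ 0 := by linarith [hx.1]
  have h2 : 1 - x ≠ 0 := by linarith [hx.2]
  have h3 : 1 - x ^ 2 ≠ 0 := by
    have : 1 - x ^ 2 = (1 + x) * (1 - x) := by ring
    rw [this]
    exact mul_ne_zero h1 h2
  have h := (((((hasDerivAt_id x).const_add 1).log h1).sub
    (((hasDerivAt_id x).const_sub 1).log h2)).sub (hasDerivAt_id x)).div_const 2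
  refine h.congr_deriv ?_
  have h4 : 1 + x ^ 2 ≠ 0 := by positivity
  simp only [exampleProfile, id]
  field_simp
  ring

theorem monotoneOn_conformalCoord : MonotoneOn conformalCoord (Ioo (-1) 1) := by
  refine monotoneOn_of_deriv_nonneg (convex_Ioo _ _)
    (contDiffOn_conformalCoord (n := 0)).continuousOn ?_ ?_ <;> rw [interior_Ioo]
  · exact fun x hx => (hasDerivAt_conformalCoord hx).differentiableAt.differentiableWithinAt
  · intro x hx
    rw [(hasDerivAt_conformalCoord hx).deriv]
    exact one_div_nonneg.mpr (exampleProfile_pos hx).le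

/-- The function `x ↦ (1 - x) exp (x / 2)`; the conformal coordinate is half the logarithm of the
quotient of its values at `-x` and `x`. -/
noncomputable def poleFactor (x : ℝ) : ℝ := (1 - x) * Real.exp (x / 2)

/-- A formula for `exp (-k |τ x - τ y|)`, with `τ` the conformal coordinate, that is continuous
up to the poles. -/
noncomputable def expKernel (k : ℕ) (x y : ℝ) : ℝ :=
  √(min (poleFactor x * poleFactor (-y)) (poleFactor (-x) * poleFactor y) /
    max (poleFactor x * poleFactor (-y)) (poleFactor (-x) * poleFactor y)) ^ k

theorem continuous_poleFactor : Continuous poleFactor := by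
  unfold poleFactor
  fun_prop

theorem poleFactor_nonneg {x : ℝ} (hx : x ≤ 1) : 0 ≤ poleFactor x :=
  mul_nonneg (by linarith) (Real.exp_nonneg _)

theorem poleFactor_pos {x : ℝ} (hx : x < 1) : 0 < poleFactor x :=
  mul_pos (by linarith) (Real.exp_pos _)

theorem log_poleFactor {x : ℝ} (hx : x < 1) :
    Real.log (poleFactor x) = Real.log (1 - x) + x / 2 := by
  rw [poleFactor, Real.log_mul (by linarith) (Real.exp_ne_zero _), Real.log_exp]

theorem min_div_max_eq_exp {a b : ℝ} (ha : 0 < a) (hb : 0 < b) :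
    min a b / max a b = Real.exp (-|Real.log b - Real.log a|) := by
  rcases le_total a b with h | h
  · rw [min_eq_left h, max_eq_right h, abs_of_nonneg (sub_nonneg.mpr (Real.log_le_log ha h)),
      neg_sub, Real.exp_sub, Real.exp_log ha, Real.exp_log hb]
  · rw [min_eq_right h, max_eq_left h, abs_of_nonpos (sub_nonpos.mpr (Real.log_le_log hb h)),
      neg_neg, Real.exp_sub, Real.exp_log ha, Real.exp_log hb]

theorem expKernel_eq_exp (k : ℕ) {x y : ℝ} (hx : x ∈ Ioo (-1 : ℝ) 1) (hy : y ∈ Ioo (-1 : ℝ) 1) :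
    expKernel k x y = Real.exp (-(k * |conformalCoord x - conformalCoord y|)) := by
  have hx' : -x < 1 := by linarith [hx.1]
  have hy' : -y < 1 := by linarith [hy.1]
  have p1 := poleFactor_pos hx.2
  have p2 := poleFactor_pos hx'
  have p3 := poleFactor_pos hy.2
  have p4 := poleFactor_pos hy'
  rw [expKernel, min_div_max_eq_exp (by positivity) (by positivity),
    Real.log_mul p1.ne' p4.ne', Real.log_mul p2.ne' p3.ne',
    log_poleFactor hx.2, log_poleFactor hx', log_poleFactor hy.2, log_poleFactor hy',
    Real.sqrt_eq_rpow, ← Real.exp_mul, ← Real.exp_nat_mul]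
  have : Real.log (1 - -x) + -x / 2 + (Real.log (1 - y) + y / 2) -
      (Real.log (1 - x) + x / 2 + (Real.log (1 - -y) + -y / 2)) =
      2 * (conformalCoord x - conformalCoord y) := by
    simp only [conformalCoord, sub_neg_eq_add]
    ring
  rw [this, abs_mul, abs_two]
  congr 1
  ring

theorem expKernel_nonneg (k : ℕ) (x y : ℝ) : 0 ≤ expKernel k x y :=
  pow_nonneg (Real.sqrt_nonneg _) _

theorem expKernel_comm (k : ℕ) (x y : ℝ) : expKernel k x y = expKernel k y x := by
  rw [expKernel, expKernel, min_comm, max_comm, mul_comm (poleFactor x),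
    mul_comm (poleFactor (-x))]

theorem expKernel_le_one (k : ℕ) {x y : ℝ} (hx : x ∈ Icc (-1 : ℝ) 1) (hy : y ∈ Icc (-1 : ℝ) 1) :
    expKernel k x y ≤ 1 := by
  refine pow_le_one₀ (Real.sqrt_nonneg _) (Real.sqrt_le_one.mpr ?_)
  refine div_le_one_of_le₀ min_le_max (le_max_of_le_left ?_)
  exact mul_nonneg (poleFactor_nonneg hx.2) (poleFactor_nonneg (by linarith [hy.1]))

theorem continuousOn_expKernel (k : ℕ) {y : ℝ} (hy : y ∈ Ioo (-1 : ℝ) 1) :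
    ContinuousOn (fun x => expKernel k x y) (Icc (-1) 1) := by
  have hc := continuous_poleFactor
  unfold expKernel
  refine ((ContinuousOn.div (by fun_prop) (by fun_prop) fun x hx => ?_).sqrt).pow k
  have p3 := poleFactor_pos hy.2
  have p4 : 0 < poleFactor (-y) := poleFactor_pos (by linarith [hy.1])
  refine ne_of_gt (lt_max_iff.mpr ?_)
  rcases lt_or_ge x 1 with h | h
  · exact Or.inl (mul_pos (poleFactor_pos h) p4)
  · exact Or.inr (mul_pos (poleFactor_pos (by linarith)) p3)

theorem expKernel_one_left {k : ℕ} (hk : k ≠ 0) {y : ℝ} (hy : y ∈ Icc (-1 : ℝ) 1) :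
    expKernel k 1 y = 0 := by
  have h : poleFactor 1 = 0 := by simp [poleFactor]
  have h' : 0 ≤ poleFactor (-1) * poleFactor y :=
    mul_nonneg (poleFactor_nonneg (by norm_num)) (poleFactor_nonneg hy.2)
  rw [expKernel, h, zero_mul, min_eq_left h', zero_div, Real.sqrt_zero, zero_pow hk]

theorem expKernel_neg_neg (k : ℕ) (x y : ℝ) : expKernel k (-x) (-y) = expKernel k x y := by
  simp only [expKernel, neg_neg]
  rw [min_comm, max_comm]

theorem exists_pos_eigenfunction_expKernel {k : ℕ} (hk : k ≠ 0) :
    ∃ M > 0, ∃ u : ℝ → ℝ, Continuous u ∧ (∀ x ∈ Ioo (-1 : ℝ) 1, 0 < u x) ∧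
      u (-1) = 0 ∧ u 1 = 0 ∧
      ∀ x ∈ Ioo (-1 : ℝ) 1, ∫ y in (-1 : ℝ)..1,
        Real.exp (-(k * |conformalCoord x - conformalCoord y|)) * u y = M * u x := by
  let μ : Measure (Icc (-1 : ℝ) 1) := Measure.comap Subtype.val volume
  have hae : ∀ᵐ (y : Icc (-1 : ℝ) 1) ∂μ, (y : ℝ) ∈ Ioo (-1 : ℝ) 1 := by
    have h : ∀ᵐ y ∂volume.restrict (Icc (-1 : ℝ) 1), y ∈ Ioo (-1 : ℝ) 1 := by
      rw [← restrict_Ioo_eq_restrict_Icc]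
      exact ae_restrict_mem measurableSet_Ioo
    exact (ae_restrict_iff_subtype measurableSet_Icc).mp h
  have huniv : μ univ = 2 := by
    rw [comap_subtype_coe_apply measurableSet_Icc, image_univ, Subtype.range_coe, Real.volume_Icc]
    norm_num
  have : IsFiniteMeasure μ := ⟨by rw [huniv]; exact ENNReal.ofNat_lt_top⟩
  have : NeZero μ := ⟨fun h => by simp [h] at huniv⟩
  have hmeas : Measurable
      (Function.uncurry fun x y : Icc (-1 : ℝ) 1 => expKernel k (x : ℝ) y) := by
    have := continuous_poleFactor.measurable
    unfold expKernel Function.uncurry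
    fun_prop
  have hpos : ∀ x : Icc (-1 : ℝ) 1, (x : ℝ) ∈ Ioo (-1 : ℝ) 1 →
      ∀ᵐ (y : Icc (-1 : ℝ) 1) ∂μ, 0 < expKernel k x y := by
    intro x hx
    filter_upwards [hae] with y hy
    rw [expKernel_eq_exp k hx hy]
    exact Real.exp_pos _
  obtain ⟨M, hM, u, huc, -, hupos, hint⟩ := exists_pos_eigenfunction_of_kernel
    (X := Icc (-1 : ℝ) 1) (μ := μ) hmeas (fun x y => expKernel_nonneg k x y)
    (fun x y => expKernel_le_one k x.2 y.2) (fun x y => expKernel_comm k x y)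
    (by
      filter_upwards [hae] with y hy
      exact continuousOn_iff_continuous_domRestrict.mp (continuousOn_expKernel k hy))
    (by
      filter_upwards [hae] with x hx using hpos x hx)
  have hle : (-1 : ℝ) ≤ 1 := by norm_num
  have hzero : ∀ x : Icc (-1 : ℝ) 1, (∀ y : Icc (-1 : ℝ) 1, expKernel k x y = 0) → u x = 0 := by
    intro x hx
    have h := hint x
    simp only [hx, zero_mul, MeasureTheory.integral_zero] at h
    exact (mul_eq_zero.mp h.symm).resolve_left hM.ne'
  refine ⟨M, hM, IccExtend hle u, huc.Icc_extend', fun x hx => ?_, ?_, ?_, fun x hx => ?_⟩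
  · rw [IccExtend_of_mem hle u (Ioo_subset_Icc_self hx)]
    exact hupos _ (hpos ⟨x, Ioo_subset_Icc_self hx⟩ hx)
  · rw [IccExtend_of_mem hle u (left_mem_Icc.mpr hle)]
    refine hzero _ fun y => ?_
    rw [← expKernel_neg_neg, neg_neg]
    exact expKernel_one_left hk ⟨by linarith [y.2.2], by linarith [y.2.1]⟩
  · rw [IccExtend_of_mem hle u (right_mem_Icc.mpr hle)]
    exact hzero _ fun y => expKernel_one_left hk y.2
  · have h := hint ⟨x, Ioo_subset_Icc_self hx⟩
    rw [IccExtend_of_mem hle u (Ioo_subset_Icc_self hx), ← h, integral_of_le hle,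
      ← integral_Icc_eq_integral_Ioc, ← integral_subtype_comap measurableSet_Icc]
    refine integral_congr_ae ?_
    filter_upwards [hae] with y hy
    rw [IccExtend_val, expKernel_eq_exp k hx hy]

/-- A positive eigenfunction `u` of `L_k` for the example metric with eigenvalue `lam`, together
with its flux `p = f u'`, which is controlled by `u`. -/
structure IsGroundState (k : ℕ) (lam : ℝ) (u p : ℝ → ℝ) : Prop where
  continuous : Continuous u
  pos : ∀ x ∈ Ioo (-1 : ℝ) 1, 0 < u x
  zero_neg_one : u (-1) = 0
  zero_one : u 1 = 0
  smoothOn : ContDiffOn ℝ (⊤ : ℕ∞) u (Ioo (-1) 1)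
  hasDerivAt : ∀ x ∈ Ioo (-1 : ℝ) 1, HasDerivAt u (p x / exampleProfile x) x
  hasDerivAt_flux : ∀ x ∈ Ioo (-1 : ℝ) 1,
    HasDerivAt p (((k : ℝ) ^ 2 / exampleProfile x - lam) * u x) x
  abs_flux_le : ∀ x ∈ Ioo (-1 : ℝ) 1, |p x| ≤ k * u x

/-- A continuous function is integrable on a bounded interval against the exponential of a
function bounded above. -/
theorem intervalIntegrable_exp_mul {h u : ℝ → ℝ} (hh : Measurable h) (hu : Continuous u)
    {a b c : ℝ} (hab : a ≤ b) (hle : ∀ y ∈ Ioo a b, h y ≤ c) :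
    IntervalIntegrable (fun y => Real.exp (h y) * u y) volume a b := by
  rw [intervalIntegrable_iff_integrableOn_Ioo_of_le hab]
  obtain ⟨C, hC⟩ := isCompact_Icc.exists_bound_of_continuousOn (hu.continuousOn (s := Icc a b))
  refine Measure.integrableOn_of_bounded (M := Real.exp c * C) (by simp)
    ((hh.exp.mul hu.measurable).aestronglyMeasurable) ?_
  filter_upwards [ae_restrict_mem measurableSet_Ioo] with y hy
  rw [norm_mul, Real.norm_of_nonneg (Real.exp_pos _).le]
  exact mul_le_mul (Real.exp_le_exp.mpr (hle y hy)) (hC y (Ioo_subset_Icc_self hy))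
    (norm_nonneg _) (Real.exp_pos _).le

/-- A function on an open set given by smooth multiples of antiderivatives of smooth multiples of
itself is smooth. -/
theorem contDiffOn_of_integral_representation {u A B α β γ δ : ℝ → ℝ} {s : Set ℝ} (hs : IsOpen s)
    (hu : ContinuousOn u s) (hα : ContDiffOn ℝ (⊤ : ℕ∞) α s) (hβ : ContDiffOn ℝ (⊤ : ℕ∞) β s)
    (hγ : ContDiffOn ℝ (⊤ : ℕ∞) γ s) (hδ : ContDiffOn ℝ (⊤ : ℕ∞) δ s)
    (hA : ∀ x ∈ s, HasDerivAt A (γ x * u x) x) (hB : ∀ x ∈ s, HasDerivAt B (δ x * u x) x)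
    (hrep : ∀ x ∈ s, u x = α x * A x + β x * B x) : ContDiffOn ℝ (⊤ : ℕ∞) u s := by
  rw [contDiffOn_infty]
  have hlift : ∀ (n : ℕ) (F ρ : ℝ → ℝ), ContDiffOn ℝ (⊤ : ℕ∞) ρ s →
      (∀ x ∈ s, HasDerivAt F (ρ x * u x) x) → ContDiffOn ℝ n u s →
      ContDiffOn ℝ ((n + 1 : ℕ) : WithTop ℕ∞) F s := by
    intro n F ρ hρ hF hn
    push_cast
    rw [contDiffOn_succ_iff_deriv_of_isOpen hs]
    refine ⟨fun x hx => (hF x hx).differentiableAt.differentiableWithinAt, by simp, ?_⟩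
    exact ((contDiffOn_infty.mp hρ n).mul hn).congr fun x hx => (hF x hx).deriv
  intro n
  induction n with
  | zero => exact contDiffOn_zero.mpr hu
  | succ n ih =>
    exact (((contDiffOn_infty.mp hα _).mul (hlift n A γ hγ hA ih)).add
      ((contDiffOn_infty.mp hβ _).mul (hlift n B δ hδ hB ih))).congr hrep

theorem exists_isGroundState {k : ℕ} (hk : k ≠ 0) :
    ∃ lam > 0, ∃ u p : ℝ → ℝ, IsGroundState k lam u p := by
  obtain ⟨M, hM, u, huc, hupos, hul, hur, hint⟩ := exists_pos_eigenfunction_expKernel hk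
  have hk' : (0 : ℝ) < k := by positivity
  have hnonneg : ∀ x ∈ Icc (-1 : ℝ) 1, 0 ≤ u x := by
    intro x hx
    rcases eq_or_lt_of_le hx.1 with h | h
    · rw [← h, hul]
    rcases eq_or_lt_of_le hx.2 with h' | h'
    · rw [h', hur]
    exact (hupos x ⟨h, h'⟩).le
  set τ := conformalCoord with hτ
  have hτm : Measurable τ := measurable_conformalCoord
  have hτs : ContDiffOn ℝ (⊤ : ℕ∞) τ (Ioo (-1) 1) := contDiffOn_conformalCoord
  have hτc : ∀ x ∈ Ioo (-1 : ℝ) 1, ContinuousAt τ x := fun x hx =>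
    (hasDerivAt_conformalCoord hx).continuousAt
  let A : ℝ → ℝ := fun x => ∫ y in (-1 : ℝ)..x, Real.exp (k * τ y) * u y
  let B : ℝ → ℝ := fun x => ∫ y in x..(1 : ℝ), Real.exp (-(k * τ y)) * u y
  have hAint : ∀ x ∈ Ioo (-1 : ℝ) 1,
      IntervalIntegrable (fun y => Real.exp (k * τ y) * u y) volume (-1) x := by
    intro x hx
    refine intervalIntegrable_exp_mul (c := k * τ x) (by fun_prop) huc hx.1.le fun y hy => ?_
    exact mul_le_mul_of_nonneg_left
      (monotoneOn_conformalCoord ⟨hy.1, hy.2.trans hx.2⟩ hx hy.2.le) hk'.le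
  have hBint : ∀ x ∈ Ioo (-1 : ℝ) 1,
      IntervalIntegrable (fun y => Real.exp (-(k * τ y)) * u y) volume x 1 := by
    intro x hx
    refine intervalIntegrable_exp_mul (c := -(k * τ x)) (by fun_prop) huc hx.2.le fun y hy => ?_
    exact neg_le_neg (mul_le_mul_of_nonneg_left
      (monotoneOn_conformalCoord hx ⟨hx.1.trans hy.1, hy.2⟩ hy.1.le) hk'.le)
  have hA : ∀ x ∈ Ioo (-1 : ℝ) 1, HasDerivAt A (Real.exp (k * τ x) * u x) x := by
    intro x hx
    have hc := hτc x hx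
    exact integral_hasDerivAt_right (hAint x hx)
      (Measurable.stronglyMeasurable (by have := huc.measurable; fun_prop)).stronglyMeasurableAtFilter
      (by have := huc.continuousAt (x := x); fun_prop)
  have hB : ∀ x ∈ Ioo (-1 : ℝ) 1, HasDerivAt B (-Real.exp (-(k * τ x)) * u x) x := by
    intro x hx
    have hc := hτc x hx
    rw [neg_mul]
    exact integral_hasDerivAt_left (hBint x hx)
      (Measurable.stronglyMeasurable (by have := huc.measurable; fun_prop)).stronglyMeasurableAtFilter
      (by have := huc.continuousAt (x := x); fun_prop)
  have hA0 : ∀ x ∈ Ioo (-1 : ℝ) 1, 0 ≤ A x := fun x hx =>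
    integral_nonneg hx.1.le fun y hy =>
      mul_nonneg (Real.exp_pos _).le (hnonneg y ⟨hy.1, hy.2.trans hx.2.le⟩)
  have hB0 : ∀ x ∈ Ioo (-1 : ℝ) 1, 0 ≤ B x := fun x hx =>
    integral_nonneg hx.2.le fun y hy =>
      mul_nonneg (Real.exp_pos _).le (hnonneg y ⟨hx.1.le.trans hy.1, hy.2⟩)
  have hrep : ∀ x ∈ Ioo (-1 : ℝ) 1,
      u x = M⁻¹ * Real.exp (-(k * τ x)) * A x + M⁻¹ * Real.exp (k * τ x) * B x := by
    intro x hx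
    have hleft : EqOn (fun y => Real.exp (-(k * |τ x - τ y|)) * u y)
        (fun y => Real.exp (-(k * τ x)) * (Real.exp (k * τ y) * u y)) (Ioo (-1) x) := by
      intro y hy
      have : τ y ≤ τ x := monotoneOn_conformalCoord ⟨hy.1, hy.2.trans hx.2⟩ hx hy.2.le
      simp only
      rw [abs_of_nonneg (sub_nonneg.mpr this), ← mul_assoc, ← Real.exp_add]
      ring_nf
    have hright : EqOn (fun y => Real.exp (-(k * |τ x - τ y|)) * u y)
        (fun y => Real.exp (k * τ x) * (Real.exp (-(k * τ y)) * u y)) (Ioo x 1) := by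
      intro y hy
      have : τ x ≤ τ y := monotoneOn_conformalCoord hx ⟨hx.1.trans hy.1, hy.2⟩ hy.1.le
      simp only
      rw [abs_of_nonpos (sub_nonpos.mpr this), ← mul_assoc, ← Real.exp_add]
      ring_nf
    have hkint : ∀ a b : ℝ, a ≤ b → IntervalIntegrable
        (fun y => Real.exp (-(k * |τ x - τ y|)) * u y) volume a b := fun a b hab =>
      intervalIntegrable_exp_mul (c := 0) (by fun_prop) huc hab fun y _ => by
        have : 0 ≤ k * |τ x - τ y| := by positivity
        linarith
    have h := hint x hx
    rw [← integral_add_adjacent_intervals (hkint (-1) x hx.1.le) (hkint x 1 hx.2.le)] at h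
    have h1 : ∫ y in (-1 : ℝ)..x, Real.exp (-(k * |τ x - τ y|)) * u y =
        Real.exp (-(k * τ x)) * A x := by
      rw [← intervalIntegral.integral_const_mul]
      exact integral_congr_Ioo_of_le hx.1.le hleft
    have h2 : ∫ y in x..(1 : ℝ), Real.exp (-(k * |τ x - τ y|)) * u y =
        Real.exp (k * τ x) * B x := by
      rw [← intervalIntegral.integral_const_mul]
      exact integral_congr_Ioo_of_le hx.2.le hright
    rw [h1, h2] at h
    rw [mul_assoc, mul_assoc, ← mul_add, h, inv_mul_cancel_left₀ hM.ne']
  have hexp : ContDiffOn ℝ (⊤ : ℕ∞) (fun x => Real.exp (k * τ x)) (Ioo (-1) 1) := by fun_prop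
  have hexpn : ContDiffOn ℝ (⊤ : ℕ∞) (fun x => Real.exp (-(k * τ x))) (Ioo (-1) 1) := by fun_prop
  have hdexp : ∀ x ∈ Ioo (-1 : ℝ) 1, HasDerivAt (fun x => Real.exp (k * τ x))
      (Real.exp (k * τ x) * (k * (1 / exampleProfile x))) x := fun x hx =>
    ((hasDerivAt_conformalCoord hx).const_mul (k : ℝ)).exp
  have hdexpn : ∀ x ∈ Ioo (-1 : ℝ) 1, HasDerivAt (fun x => Real.exp (-(k * τ x)))
      (Real.exp (-(k * τ x)) * -(k * (1 / exampleProfile x))) x := fun x hx =>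
    ((hasDerivAt_conformalCoord hx).const_mul (k : ℝ)).neg.exp
  refine ⟨2 * k / M, by positivity, u,
    fun x => k * (M⁻¹ * Real.exp (k * τ x) * B x - M⁻¹ * Real.exp (-(k * τ x)) * A x),
    huc, hupos, hul, hur, ?_, fun x hx => ?_, fun x hx => ?_, fun x hx => ?_⟩
  · exact contDiffOn_of_integral_representation isOpen_Ioo huc.continuousOn
      (contDiffOn_const.mul hexpn) (contDiffOn_const.mul hexp) hexp hexpn.neg hA hB hrep
  · have hd := (((hdexpn x hx).const_mul M⁻¹).mul (hA x hx)).add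
      (((hdexp x hx).const_mul M⁻¹).mul (hB x hx))
    refine (hd.congr_of_eventuallyEq ?_).congr_deriv ?_
    · filter_upwards [isOpen_Ioo.mem_nhds hx] with y hy using hrep y hy
    · have := (exampleProfile_pos hx).ne'
      field_simp
      ring
  · have hd := ((((hdexp x hx).const_mul M⁻¹).mul (hB x hx)).sub
      (((hdexpn x hx).const_mul M⁻¹).mul (hA x hx))).const_mul (k : ℝ)
    refine hd.congr_deriv ?_
    have hf := (exampleProfile_pos hx).ne'
    have he : Real.exp (k * τ x) * Real.exp (-(k * τ x)) = 1 := by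
      rw [← Real.exp_add, add_neg_cancel, Real.exp_zero]
    have hr := hrep x hx
    have hsub : ((k : ℝ) ^ 2 / exampleProfile x - 2 * k / M) * u x =
        (k : ℝ) ^ 2 / exampleProfile x * (M⁻¹ * Real.exp (-(k * τ x)) * A x +
          M⁻¹ * Real.exp (k * τ x) * B x) - 2 * k / M * u x *
          (Real.exp (k * τ x) * Real.exp (-(k * τ x))) := by
      rw [← hr, he]
      ring
    rw [hsub]
    field_simp
    ring
  · have h1 := hA0 x hx
    have h2 := hB0 x hx
    have h3 : 0 ≤ M⁻¹ * Real.exp (-(k * τ x)) * A x := by positivity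
    have h4 : 0 ≤ M⁻¹ * Real.exp (k * τ x) * B x := by positivity
    rw [abs_mul, abs_of_pos hk', hrep x hx]
    refine mul_le_mul_of_nonneg_left (abs_le.mpr ⟨?_, ?_⟩) hk'.le <;> linarith

/-- A function on `[-1,1]`, continuous inside and dominated by a continuous function vanishing at
the endpoints, is continuous. -/
theorem continuousOn_Icc_of_abs_le {W g : ℝ → ℝ} (hW : ContinuousOn W (Ioo (-1) 1))
    (hg : ContinuousOn g (Icc (-1) 1)) (hle : ∀ x ∈ Icc (-1 : ℝ) 1, |W x| ≤ g x)
    (hgl : g (-1) = 0) (hgr : g 1 = 0) : ContinuousOn W (Icc (-1) 1) := by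
  have hend : ∀ x ∈ Icc (-1 : ℝ) 1, g x = 0 → ContinuousWithinAt W (Icc (-1) 1) x := by
    intro x hx h0
    have hWx : W x = 0 := abs_nonpos_iff.mp (h0 ▸ hle x hx)
    have hgx := hg x hx
    rw [ContinuousWithinAt, h0] at hgx
    rw [ContinuousWithinAt, hWx]
    refine squeeze_zero_norm' ?_ hgx
    filter_upwards [self_mem_nhdsWithin] with y hy using hle y hy
  intro x hx
  rcases eq_or_lt_of_le hx.1 with h | h
  · exact hend x hx (h ▸ hgl)
  rcases eq_or_lt_of_le hx.2 with h' | h'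
  · exact hend x hx (h' ▸ hgr)
  · exact (hW.continuousAt (isOpen_Ioo.mem_nhds ⟨h, h'⟩)).continuousWithinAt

theorem continuous_exampleProfile : Continuous exampleProfile := by
  unfold exampleProfile
  exact Continuous.div (by fun_prop) (by fun_prop) fun x => by positivity

theorem hasDerivAt_exampleProfile (x : ℝ) :
    HasDerivAt exampleProfile (-8 * x / (1 + x ^ 2) ^ 2) x := by
  have h4 : 1 + x ^ 2 ≠ 0 := by positivity
  have h := ((((hasDerivAt_id x).pow 2).const_sub 1).const_mul 2).div
    (((hasDerivAt_id x).pow 2).const_add 1) h4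
  refine h.congr_deriv ?_
  simp only [id, Pi.pow_apply]
  field_simp
  ring

theorem exampleProfile_one : exampleProfile 1 = 0 := by norm_num [exampleProfile]

theorem exampleProfile_neg_one : exampleProfile (-1) = 0 := by norm_num [exampleProfile]

/-- A primitive of a quarter of the square of the derivative of `exampleProfile`. -/
noncomputable def gradientPrimitive (x : ℝ) : ℝ :=
  Real.arctan x + x / (1 + x ^ 2) + 2 / 3 * (x / (1 + x ^ 2) ^ 2) - 8 / 3 * (x / (1 + x ^ 2) ^ 3)

theorem hasDerivAt_gradientPrimitive (x : ℝ) :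
    HasDerivAt gradientPrimitive ((-8 * x / (1 + x ^ 2) ^ 2) ^ 2 / 4) x := by
  have h4 : 1 + x ^ 2 ≠ 0 := by positivity
  have hq : HasDerivAt (fun x : ℝ => 1 + x ^ 2) (2 * x) x := by
    simpa using ((hasDerivAt_id x).pow 2).const_add 1
  have hi := hasDerivAt_id x
  have h := (((Real.hasDerivAt_arctan x).add (hi.div hq h4)).add
    ((hi.div (hq.pow 2) (pow_ne_zero 2 h4)).const_mul (2 / 3))).sub
    ((hi.div (hq.pow 3) (pow_ne_zero 3 h4)).const_mul (8 / 3))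
  refine h.congr_deriv ?_
  simp only [id, Pi.pow_apply]
  field_simp
  ring

theorem continuous_gradientPrimitive : Continuous gradientPrimitive :=
  continuous_iff_continuousAt.mpr fun x => (hasDerivAt_gradientPrimitive x).continuousAt

namespace IsGroundState

variable {k j : ℕ} {lam lam' : ℝ} {u v p q : ℝ → ℝ}

theorem inSpec (h : IsGroundState k lam u p) : InSpec exampleProfile k lam := by
  refine ⟨u, h.continuous.continuousOn, h.smoothOn, ⟨0, by norm_num, (h.pos 0 (by norm_num)).ne'⟩,
    fun _ => ⟨h.zero_neg_one, h.zero_one⟩, fun x hx => ?_⟩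
  have heq : (fun y => exampleProfile y * deriv u y) =ᶠ[nhds x] p := by
    filter_upwards [isOpen_Ioo.mem_nhds hx] with y hy
    rw [(h.hasDerivAt y hy).deriv, mul_div_cancel₀ _ (exampleProfile_pos hy).ne']
  rw [heq.deriv_eq, (h.hasDerivAt_flux x hx).deriv]
  ring

/-- The Rayleigh-type bound obtained from the Riccati equation satisfied by `p / u`. -/
theorem le_bound (h : IsGroundState k lam u p) :
    lam ≤ (k : ℝ) ^ 2 / (Real.pi - 2) + (3 * Real.pi + 4) / (12 * Real.pi - 24) := by
  have hprofile : ∀ x ∈ Icc (-1 : ℝ) 1, 0 ≤ exampleProfile x := by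
    intro x hx
    have : 0 ≤ 1 - x ^ 2 := by nlinarith [hx.1, hx.2]
    unfold exampleProfile
    positivity
  have hderiv : ∀ x ∈ Ioo (-1 : ℝ) 1, HasDerivAt (fun x => p x / u x * exampleProfile x)
      ((((k : ℝ) ^ 2 / exampleProfile x - lam) * u x * u x -
        p x * (p x / exampleProfile x)) / u x ^ 2 * exampleProfile x +
        p x / u x * (-8 * x / (1 + x ^ 2) ^ 2)) x := fun x hx =>
    ((h.hasDerivAt_flux x hx).div (h.hasDerivAt x hx) (h.pos x hx).ne').mul
      (hasDerivAt_exampleProfile x)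
  have hcont : ContinuousOn (fun x => p x / u x * exampleProfile x) (Icc (-1) 1) := by
    refine continuousOn_Icc_of_abs_le (g := fun x => k * exampleProfile x)
      (fun x hx => (hderiv x hx).continuousAt.continuousWithinAt)
      (continuous_const.mul continuous_exampleProfile).continuousOn (fun x hx => ?_)
      (by simp [exampleProfile_neg_one]) (by simp [exampleProfile_one])
    rw [abs_mul, abs_of_nonneg (hprofile x hx)]
    refine mul_le_mul_of_nonneg_right ?_ (hprofile x hx)
    rcases eq_or_lt_of_le hx.1 with hl | hl
    · rw [← hl, h.zero_neg_one]
      simp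
    rcases eq_or_lt_of_le hx.2 with hr | hr
    · rw [hr, h.zero_one]
      simp
    have hpos := h.pos x ⟨hl, hr⟩
    rw [abs_div, abs_of_pos hpos, div_le_iff₀ hpos]
    exact h.abs_flux_le x ⟨hl, hr⟩
  have hanti : AntitoneOn (fun x => p x / u x * exampleProfile x - (k : ℝ) ^ 2 * x +
      lam * (4 * Real.arctan x - 2 * x) - gradientPrimitive x) (Icc (-1) 1) := by
    have hd : ∀ x ∈ Ioo (-1 : ℝ) 1, HasDerivAt (fun x => p x / u x * exampleProfile x -
        (k : ℝ) ^ 2 * x + lam * (4 * Real.arctan x - 2 * x) - gradientPrimitive x)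
        (-(p x / u x - -8 * x / (1 + x ^ 2) ^ 2 / 2) ^ 2) x := by
      intro x hx
      refine ((((hderiv x hx).sub ((hasDerivAt_id x).const_mul ((k : ℝ) ^ 2))).add
        ((((Real.hasDerivAt_arctan x).const_mul 4).sub
          ((hasDerivAt_id x).const_mul 2)).const_mul lam)).sub
        (hasDerivAt_gradientPrimitive x)).congr_deriv ?_
      have hf := (exampleProfile_pos hx).ne'
      have hu := (h.pos x hx).ne'
      have h4 : 1 + x ^ 2 ≠ 0 := by positivity
      have hfx : 4 * (1 / (1 + x ^ 2)) - 2 * 1 = exampleProfile x := by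
        unfold exampleProfile
        field_simp
        ring
      rw [hfx]
      generalize exampleProfile x = F at hf ⊢
      field_simp
      ring
    refine antitoneOn_of_deriv_nonpos (convex_Icc _ _) ?_ ?_ ?_
    · have := continuous_gradientPrimitive
      have := Real.continuous_arctan
      fun_prop
    · rw [interior_Icc]
      exact fun x hx => (hd x hx).differentiableAt.differentiableWithinAt
    · rw [interior_Icc]
      intro x hx
      rw [(hd x hx).deriv]
      exact neg_nonpos.mpr (sq_nonneg _)
  have hends := hanti (left_mem_Icc.mpr (by norm_num)) (right_mem_Icc.mpr (by norm_num))
    (by norm_num : (-1 : ℝ) ≤ 1)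
  simp only [exampleProfile_one, exampleProfile_neg_one, gradientPrimitive, Real.arctan_neg,
    Real.arctan_one] at hends
  norm_num at hends
  have hpi : 0 < Real.pi - 2 := by linarith [Real.pi_gt_three]
  have hsum : (k : ℝ) ^ 2 / (Real.pi - 2) + (3 * Real.pi + 4) / (12 * Real.pi - 24) =
      ((k : ℝ) ^ 2 + Real.pi / 4 + 1 / 3) / (Real.pi - 2) := by
    have : 12 * Real.pi - 24 = 12 * (Real.pi - 2) := by ring
    rw [this]
    field_simp
    ring
  rw [hsum, le_div_iff₀ hpi]
  linarith

/-- Ground state energies increase strictly with the angular momentum. -/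
theorem lt_of_lt (h : IsGroundState k lam u p) (h' : IsGroundState j lam' v q) (hkj : k < j) :
    lam < lam' := by
  by_contra! hle
  have hd : ∀ x ∈ Ioo (-1 : ℝ) 1, HasDerivAt (fun x => p x * v x - u x * q x)
      ((((k : ℝ) ^ 2 - j ^ 2) / exampleProfile x - (lam - lam')) * (u x * v x)) x := by
    intro x hx
    refine (((h.hasDerivAt_flux x hx).mul (h'.hasDerivAt x hx)).sub
      ((h.hasDerivAt x hx).mul (h'.hasDerivAt_flux x hx))).congr_deriv ?_
    ring
  have hcont : ContinuousOn (fun x => p x * v x - u x * q x) (Icc (-1) 1) := by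
    refine continuousOn_Icc_of_abs_le (g := fun x => (k + j) * (u x * v x))
      (fun x hx => (hd x hx).continuousAt.continuousWithinAt)
      (continuous_const.mul (h.continuous.mul h'.continuous)).continuousOn (fun x hx => ?_)
      (by simp [h.zero_neg_one]) (by simp [h.zero_one])
    rcases eq_or_lt_of_le hx.1 with hl | hl
    · simp [← hl, h.zero_neg_one, h'.zero_neg_one]
    rcases eq_or_lt_of_le hx.2 with hr | hr
    · simp [hr, h.zero_one, h'.zero_one]
    have hu := h.pos x ⟨hl, hr⟩
    have hv := h'.pos x ⟨hl, hr⟩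
    have hp := mul_le_mul_of_nonneg_right (h.abs_flux_le x ⟨hl, hr⟩) hv.le
    have hq := mul_le_mul_of_nonneg_left (h'.abs_flux_le x ⟨hl, hr⟩) hu.le
    refine (abs_sub _ _).trans ?_
    rw [abs_mul, abs_mul, abs_of_pos hu, abs_of_pos hv]
    linarith
  have hanti : StrictAntiOn (fun x => p x * v x - u x * q x) (Icc (-1) 1) := by
    refine strictAntiOn_of_deriv_neg (convex_Icc _ _) hcont fun x hx => ?_
    rw [interior_Icc] at hx
    rw [(hd x hx).deriv]
    refine mul_neg_of_neg_of_pos ?_ (mul_pos (h.pos x hx) (h'.pos x hx))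
    have hkj' : (k : ℝ) ^ 2 - j ^ 2 < 0 := by
      have : (k : ℝ) < j := by exact_mod_cast hkj
      have : (0 : ℝ) ≤ k := k.cast_nonneg
      nlinarith
    linarith [div_neg_of_neg_of_pos hkj' (exampleProfile_pos hx)]
  have hends := hanti (left_mem_Icc.mpr (by norm_num)) (right_mem_Icc.mpr (by norm_num))
    (by norm_num : (-1 : ℝ) < 1)
  simp [h.zero_one, h'.zero_one, h.zero_neg_one, h'.zero_neg_one] at hends

end IsGroundState

theorem zero_inSpec (f : ℝ → ℝ) : InSpec f 0 0 :=
  ⟨fun _ => 1, continuousOn_const, contDiffOn_const, ⟨0, by norm_num, one_ne_zero⟩,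
    fun h => absurd h (by norm_num), fun x _ => by simp⟩

/-- For the example metric there is a strictly increasing sequence of eigenvalues starting at
zero and satisfying the Rayleigh-type bounds. -/
theorem exists_strictMono_eigenvalues : ∃ e : ℕ → ℝ, StrictMono e ∧ e 0 = 0 ∧
    (∀ m, e m ∈ Eigs exampleProfile) ∧ ∀ m : ℕ, 1 ≤ m →
      e m ≤ (m : ℝ) ^ 2 / (Real.pi - 2) + (3 * Real.pi + 4) / (12 * Real.pi - 24) := by
  choose lam hpos u p hground using fun n : ℕ => exists_isGroundState n.succ_ne_zero
  let e : ℕ → ℝ := fun m => Nat.casesOn m 0 lam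
  refine ⟨e, strictMono_nat_of_lt_succ fun n => ?_, rfl, fun m => ?_, fun m hm => ?_⟩
  · cases n with
    | zero => exact hpos 0
    | succ n => exact (hground n).lt_of_lt (hground (n + 1)) (Nat.lt_succ_self _)
  · cases m with
    | zero => exact mem_iUnion.mpr ⟨0, zero_inSpec _⟩
    | succ m => exact mem_iUnion.mpr ⟨m + 1, (hground m).inSpec⟩
  · obtain ⟨n, rfl⟩ := Nat.exists_eq_succ_of_ne_zero (Nat.one_le_iff_ne_zero.mp hm)
    exact (hground n).le_bound

/-- The `m`-th term of a strictly increasing enumeration is at most the `m`-th term of any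
strictly increasing sequence in its range. -/
theorem StrictMono.le_of_mem_range {Λ e : ℕ → ℝ} (hΛ : StrictMono Λ) (he : StrictMono e)
    (hmem : ∀ m, e m ∈ range Λ) (m : ℕ) : Λ m ≤ e m := by
  choose σ hσ using hmem
  have hσmono : StrictMono σ := fun a b hab => by
    rw [← hΛ.lt_iff_lt, hσ, hσ]
    exact he hab
  rw [← hσ m]
  exact hΛ.monotone (hσmono.le_apply)

/-- For the example metric `f(x) = 2(1-x²)/(1+x²)`, every distinct eigenvalue satisfies
`λ_m ≤ m²/(π-2) + (3π+4)/(12π-24)`, and consequently `λ_m < m² + 1` for all `m`. -/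
theorem example_metric_eigenvalue_bounds
    (Λ : ℕ → ℝ) (hΛmono : StrictMono Λ)
    (hΛrange : Set.range Λ = Eigs (fun x : ℝ => 2 * (1 - x^2) / (1 + x^2))) :
    (∀ m : ℕ, 1 ≤ m →
      Λ m ≤ (m:ℝ)^2 / (Real.pi - 2) + (3 * Real.pi + 4) / (12 * Real.pi - 24)) ∧
    (∀ m : ℕ, Λ m < (m:ℝ)^2 + 1) := by
  obtain ⟨e, hemono, he0, hemem, hebound⟩ := exists_strictMono_eigenvalues
  have hle : ∀ m, Λ m ≤ e m := hΛmono.le_of_mem_range hemono fun m => hΛrange ▸ hemem m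
  refine ⟨fun m hm => (hle m).trans (hebound m hm), fun m => ?_⟩
  rcases Nat.eq_zero_or_pos m with rfl | hm
  · have := hle 0
    rw [he0] at this
    norm_num
    linarith
  · refine ((hle m).trans (hebound m hm)).trans_lt ?_
    have hpi := Real.pi_gt_d2
    have h1 : (m : ℝ) ^ 2 / (Real.pi - 2) ≤ (m : ℝ) ^ 2 :=
      div_le_self (sq_nonneg _) (by linarith)
    have h2 : (3 * Real.pi + 4) / (12 * Real.pi - 24) < 1 := by
      rw [div_lt_one (by linarith)]
      linarith
    linarith
end
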